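/- arXiv:cs/0511086 — 10 statements merged into one kernel-verified Lean document; each statement's English description precedes it below -/
import Mathlib

section
/- Let w1, w2, μ1, μ2, h1, h2 be positive reals with w1 < w2, and define f1(x) = (μ1/h1)·(2^{x/w1} − 1) and f2(x) = (μ2/h2)·(2^{x/w2} − 1) for x ≥ 0. If μ1/(w1·h1) < μ2/(w2·h2), then there exists a unique v0 > 0 such that f1(v0) = f2(v0); moreover f2(x) > f1(x) for all x with 0 < x < v0, and f2(x) < f1(x) for all x > v0. -/
/-- For `1 < p < k`, the graph of `y ↦ y ^ p` meets the line of slope `k` through `(1, 1)` at some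
`y > 1`. -/
lemma exists_rpow_sub_one_eq_mul {p k : ℝ} (hp : 1 < p) (hk : p < k) :
    ∃ y : ℝ, 1 < y ∧ y ^ p - 1 = k * (y - 1) := by
  have hder : HasDerivAt (fun y : ℝ => y ^ p - k * y) (p - k) 1 := by
    have h := (Real.hasDerivAt_rpow_const (p := p) (Or.inl one_ne_zero)).fun_sub
      ((hasDerivAt_id' (1 : ℝ)).const_mul k)
    rwa [Real.one_rpow, mul_one, mul_one] at h
  obtain ⟨a, ha, ha1⟩ : ∃ a : ℝ, a ^ p - 1 - k * (a - 1) < 0 ∧ 1 < a := by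
    have hslope := (hasDerivWithinAt_iff_tendsto_slope' Set.self_notMem_Ioi).mp
      (hder.hasDerivWithinAt (s := Set.Ioi 1))
    have hneg := hslope.eventually (gt_mem_nhds (sub_neg.mpr hk))
    obtain ⟨a, ha, ha1⟩ := (hneg.and self_mem_nhdsWithin).exists
    have ha1 : 1 < a := ha1
    rw [slope_def_field, div_neg_iff] at ha
    refine ⟨a, ?_, ha1⟩
    rcases ha with ha | ha
    · linarith [ha.2]
    · have := ha.1
      rw [Real.one_rpow] at this
      linarith
  obtain ⟨b, hb, hb1⟩ : ∃ b : ℝ, 0 < b ^ p - 1 - k * (b - 1) ∧ 1 < b := by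
    have hp' : 0 < p - 1 := by linarith
    have hb1 : 1 < (k + 1) ^ (p - 1)⁻¹ := Real.one_lt_rpow (by linarith) (inv_pos.mpr hp')
    refine ⟨(k + 1) ^ (p - 1)⁻¹, ?_, hb1⟩
    have hpow : ((k + 1) ^ (p - 1)⁻¹) ^ (p - 1) = k + 1 :=
      Real.rpow_inv_rpow (by linarith) hp'.ne'
    rw [Real.rpow_sub_one (by positivity), div_eq_iff (by positivity)] at hpow
    rw [hpow]
    linarith
  have hcont : ContinuousOn (fun y : ℝ => y ^ p - 1 - k * (y - 1)) (Set.uIcc a b) :=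
    (((Real.continuous_rpow_const (by linarith)).sub continuous_const).sub
      (by fun_prop)).continuousOn
  obtain ⟨y, hy, hy0⟩ := intermediate_value_uIcc hcont
    (Set.mem_uIcc.mpr (Or.inl ⟨ha.le, hb.le⟩) : (0 : ℝ) ∈ _)
  exact ⟨y, (lt_min ha1 hb1).trans_le hy.1, sub_eq_zero.mp hy0⟩

/-- For `1 < p`, the slope of the secant of `y ↦ y ^ p` based at `1` is strictly increasing. -/
lemma rpow_sub_one_div_lt {p y z : ℝ} (hp : 1 < p) (hy : 1 < y) (hyz : y < z) :
    (y ^ p - 1) / (y - 1) < (z ^ p - 1) / (z - 1) := by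
  simpa using (strictConvexOn_rpow hp).secant_strict_mono (a := 1) (x := y) (y := z)
    (Set.mem_Ici.mpr zero_le_one) (Set.mem_Ici.mpr (by linarith)) (Set.mem_Ici.mpr (by linarith))
    (ne_of_gt hy) (ne_of_gt (hy.trans hyz)) hyz

/-- If `w1 < w2` and `μ1/(w1·h1) < μ2/(w2·h2)`, the two power-cost∼rate-reward
curves cross exactly once at some `v0 > 0`, with `f2 > f1` before `v0` and `f2 < f1` after. -/
theorem stmt1 (w1 w2 μ1 μ2 h1 h2 : ℝ)
    (hw1 : 0 < w1) (hw2 : 0 < w2) (hμ1 : 0 < μ1) (hμ2 : 0 < μ2)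
    (hh1 : 0 < h1) (hh2 : 0 < h2) (hw : w1 < w2)
    (f1 f2 : ℝ → ℝ)
    (hf1 : ∀ x, f1 x = μ1 / h1 * ((2 : ℝ) ^ (x / w1) - 1))
    (hf2 : ∀ x, f2 x = μ2 / h2 * ((2 : ℝ) ^ (x / w2) - 1))
    (hcond : μ1 / (w1 * h1) < μ2 / (w2 * h2)) :
    ∃ v0 : ℝ, 0 < v0 ∧ f1 v0 = f2 v0 ∧
      (∀ v : ℝ, 0 < v → f1 v = f2 v → v = v0) ∧
      (∀ x : ℝ, 0 < x → x < v0 → f1 x < f2 x) ∧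
      (∀ x : ℝ, v0 < x → f2 x < f1 x) := by
  have hp : 1 < w2 / w1 := (one_lt_div hw1).mpr hw
  have hA : 0 < μ1 / h1 := by positivity
  have hk : w2 / w1 < μ2 / h2 / (μ1 / h1) := by
    rw [lt_div_iff₀ hA]
    calc w2 / w1 * (μ1 / h1) = w2 * (μ1 / (w1 * h1)) := by field_simp
      _ < w2 * (μ2 / (w2 * h2)) := by gcongr
      _ = μ2 / h2 := by field_simp
  obtain ⟨y, hy1, hy⟩ := exists_rpow_sub_one_eq_mul hp hk
  have hsub : ∀ x, (2 : ℝ) ^ (x / w1) = ((2 : ℝ) ^ (x / w2)) ^ (w2 / w1) := fun x => by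
    rw [← Real.rpow_mul zero_le_two]
    congr 1
    field_simp
  have hv0 : (2 : ℝ) ^ (w2 * Real.logb 2 y / w2) = y := by
    rw [mul_div_cancel_left₀ _ hw2.ne',
      Real.rpow_logb two_pos (by norm_num) (by linarith)]
  have hmono : ∀ {u v : ℝ}, u < v → (2 : ℝ) ^ (u / w2) < 2 ^ (v / w2) := fun huv =>
    Real.rpow_lt_rpow_of_exponent_lt one_lt_two (by gcongr)
  have hone : ∀ {x : ℝ}, 0 < x → 1 < (2 : ℝ) ^ (x / w2) := fun hx =>
    Real.one_lt_rpow one_lt_two (by positivity)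
  have hpos : 0 < w2 * Real.logb 2 y := mul_pos hw2 (Real.logb_pos one_lt_two hy1)
  have hslope : (y ^ (w2 / w1) - 1) / (y - 1) = μ2 / h2 / (μ1 / h1) := by
    rw [hy, mul_div_cancel_right₀ _ (by linarith)]
  have hbefore : ∀ x : ℝ, 0 < x → x < w2 * Real.logb 2 y → f1 x < f2 x := by
    intro x hx hxv
    have hxy := hmono hxv
    rw [hv0] at hxy
    have h := rpow_sub_one_div_lt hp (hone hx) hxy
    rw [hslope, div_lt_div_iff₀ (sub_pos.mpr (hone hx)) hA] at h
    rw [hf1, hf2, hsub]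
    linarith
  have hafter : ∀ x : ℝ, w2 * Real.logb 2 y < x → f2 x < f1 x := by
    intro x hxv
    have hxy := hmono hxv
    rw [hv0] at hxy
    have h := rpow_sub_one_div_lt hp hy1 hxy
    rw [hslope, div_lt_div_iff₀ hA (sub_pos.mpr (hy1.trans hxy))] at h
    rw [hf1, hf2, hsub]
    linarith
  refine ⟨w2 * Real.logb 2 y, hpos, ?_, ?_, hbefore, hafter⟩
  · rw [hf1, hf2, hsub, hv0, hy]
    field_simp
  · intro v hv hfv
    rcases lt_trichotomy v (w2 * Real.logb 2 y) with h | h | h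
    · exact absurd hfv (hbefore v hv h).ne
    · exact h
    · exact absurd hfv (hafter v h).ne'
end

section
/- Let w1, w2, μ1, μ2, h1, h2 be positive reals with w1 < w2 and μ1/(w1·h1) < μ2/(w2·h2), and define f1(x) = (μ1/h1)·(2^{x/w1} − 1) and f2(x) = (μ2/h2)·(2^{x/w2} − 1). Then there exist unique s0 > 0 and 0 < Ra < Rb such that f1'(Ra) = f2'(Rb) = s0 and f2(Rb) − f1(Ra) = s0·(Rb − Ra) (a common tangent line to the two curves). Moreover Ra = w1·log(s0·w1·h1/(ln 2·μ1)), Rb = w2·log(s0·w2·h2/(ln 2·μ2)), and s0 satisfies g(s0) = 0, where g(x) := x·( w2·log(x·w2·h2/(ln 2·μ2)) − w1·log(x·w1·h1/(ln 2·μ1)) − (w2 − w1)/ln 2 ) + μ2/h2 − μ1/h1. -/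
/-- Existence and uniqueness of the zero of `x * (a * log x - b - a) + K` on the part of the
positive axis where its derivative `a * log x - b` is positive. -/
theorem exists_unique_zero_mul_log {a b K c : ℝ} (ha : 0 < a) (hc : 0 < c)
    (hGc : c * (a * Real.log c - b - a) + K < 0) :
    ∃ s, c < s ∧ 0 < a * Real.log s - b ∧ s * (a * Real.log s - b - a) + K = 0 ∧
      ∀ t, 0 < t → 0 < a * Real.log t - b → t * (a * Real.log t - b - a) + K = 0 → t = s := by
  have tangent : ∀ x y : ℝ, 0 < x → 0 < y →
      y * (a * Real.log y - b - a) + K + (a * Real.log y - b) * (x - y) ≤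
        x * (a * Real.log x - b - a) + K := by
    intro x y hx hy
    have h := Real.log_le_sub_one_of_pos (div_pos hy hx)
    rw [Real.log_div hy.ne' hx.ne'] at h
    have h' : x * (Real.log y - Real.log x) ≤ y - x := by
      calc x * (Real.log y - Real.log x) ≤ x * (y / x - 1) := by gcongr
        _ = y - x := by field_simp
    nlinarith [mul_le_mul_of_nonneg_left h' ha.le]
  obtain ⟨S, hcS, hGS⟩ : ∃ S, c ≤ S ∧ 0 ≤ S * (a * Real.log S - b - a) + K := by
    refine ⟨max (max 1 c) (Real.exp ((a + b + |K|) / a)),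
      (le_max_right _ _).trans (le_max_left _ _), ?_⟩
    set S := max (max 1 c) (Real.exp ((a + b + |K|) / a))
    have hS1 : 1 ≤ S := (le_max_left _ _).trans (le_max_left _ _)
    have hlog : (a + b + |K|) / a ≤ Real.log S :=
      (Real.le_log_iff_exp_le (by linarith)).2 (le_max_right _ _)
    rw [div_le_iff₀ ha] at hlog
    nlinarith [neg_abs_le K, abs_nonneg K]
  have hcont : ContinuousOn (fun x => x * (a * Real.log x - b - a) + K) (Set.Icc c S) := by
    have hlog : ContinuousOn Real.log (Set.Icc c S) :=
      Real.continuousOn_log.mono fun x hx => (hc.trans_le hx.1).ne'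
    fun_prop
  obtain ⟨s, ⟨hcs, -⟩, hs⟩ := intermediate_value_Icc hcS hcont ⟨hGc.le, hGS⟩
  simp only at hs
  have hcs' : c < s := lt_of_le_of_ne hcs (by rintro rfl; linarith)
  have hs0 : 0 < s := hc.trans hcs'
  have hds : 0 < a * Real.log s - b := by
    by_contra! h
    nlinarith [tangent c s hc hs0]
  refine ⟨s, hcs', hds, hs, fun t ht hdt hGt => ?_⟩
  rcases lt_trichotomy t s with h | h | h
  · nlinarith [tangent s t hs0 ht, mul_pos hdt (sub_pos.2 h)]
  · exact h
  · nlinarith [tangent t s ht hs0, mul_pos hds (sub_pos.2 h)]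

/-- The derivative of a power-cost∼rate-reward function. -/
theorem deriv_powerCost {w μ h : ℝ} {f : ℝ → ℝ}
    (hf : ∀ x, f x = μ / h * ((2 : ℝ) ^ (x / w) - 1)) (x : ℝ) :
    deriv f x = Real.log 2 * μ / (w * h) * (2 : ℝ) ^ (x / w) := by
  have hd : HasDerivAt f (μ / h * (Real.log 2 * (1 / w) * (2 : ℝ) ^ (x / w))) x := by
    rw [funext hf]
    exact ((((hasDerivAt_id x).div_const w).const_rpow (by norm_num : (0 : ℝ) < 2)).sub_const
      1).const_mul (μ / h)
  rw [hd.deriv]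
  ring

theorem powerCost_eq_deriv {w μ h : ℝ} (hw : 0 < w) {f : ℝ → ℝ}
    (hf : ∀ x, f x = μ / h * ((2 : ℝ) ^ (x / w) - 1)) (x : ℝ) :
    f x = deriv f x * w / Real.log 2 - μ / h := by
  have hL : Real.log 2 ≠ 0 := (Real.log_pos one_lt_two).ne'
  rw [deriv_powerCost hf, hf]
  field_simp

theorem deriv_powerCost_eq_iff {w μ h s : ℝ} (hw : 0 < w) (hμ : 0 < μ) (hh : 0 < h) (hs : 0 < s)
    {f : ℝ → ℝ} (hf : ∀ x, f x = μ / h * ((2 : ℝ) ^ (x / w) - 1)) (x : ℝ) :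
    deriv f x = s ↔ x = w * Real.logb 2 (s * w * h / (Real.log 2 * μ)) := by
  have hL : 0 < Real.log 2 := Real.log_pos one_lt_two
  have hq : 0 < s * w * h / (Real.log 2 * μ) := by positivity
  rw [deriv_powerCost hf, mul_comm w (Real.logb _ _), ← div_eq_iff hw.ne', eq_comm (a := x / w),
    Real.logb_eq_iff_rpow_eq two_pos (by norm_num) hq, eq_div_iff (by positivity),
    div_mul_eq_mul_div, div_eq_iff (by positivity)]
  constructor <;> intro H <;> linarith

theorem mul_logb_two_eq {w μ h s : ℝ} (hw : 0 < w) (hμ : 0 < μ) (hh : 0 < h) (hs : 0 < s) :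
    w * Real.logb 2 (s * w * h / (Real.log 2 * μ)) =
      w * (Real.log s - Real.log (Real.log 2 * (μ / (w * h)))) / Real.log 2 := by
  have hL : 0 < Real.log 2 := Real.log_pos one_lt_two
  have hq : s * w * h / (Real.log 2 * μ) = s / (Real.log 2 * (μ / (w * h))) := by field_simp
  rw [← Real.log_div hs.ne' (by positivity), hq, Real.logb, mul_div_assoc w]

/-- existence and uniqueness of the common tangent line data `(s0, Ra, Rb)`
of the two power-cost∼rate-reward curves, together with the closed-form expressions for
`Ra`, `Rb` and the equation `g(s0) = 0` determining the slope `s0`. -/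
theorem stmt3 (w1 w2 μ1 μ2 h1 h2 : ℝ)
    (hw1 : 0 < w1) (hw2 : 0 < w2) (hμ1 : 0 < μ1) (hμ2 : 0 < μ2)
    (hh1 : 0 < h1) (hh2 : 0 < h2) (hw : w1 < w2)
    (hcond : μ1 / (w1 * h1) < μ2 / (w2 * h2))
    (f1 f2 g : ℝ → ℝ)
    (hf1 : ∀ x, f1 x = μ1 / h1 * ((2 : ℝ) ^ (x / w1) - 1))
    (hf2 : ∀ x, f2 x = μ2 / h2 * ((2 : ℝ) ^ (x / w2) - 1))
    (hg : ∀ x, g x = x * (w2 * Real.logb 2 (x * w2 * h2 / (Real.log 2 * μ2))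
        - w1 * Real.logb 2 (x * w1 * h1 / (Real.log 2 * μ1))
        - (w2 - w1) / Real.log 2) + μ2 / h2 - μ1 / h1) :
    ∃ s0 Ra Rb : ℝ,
      (0 < s0 ∧ 0 < Ra ∧ Ra < Rb ∧
        deriv f1 Ra = s0 ∧ deriv f2 Rb = s0 ∧
        f2 Rb - f1 Ra = s0 * (Rb - Ra)) ∧
      (∀ s0' Ra' Rb' : ℝ, 0 < s0' → 0 < Ra' → Ra' < Rb' →
        deriv f1 Ra' = s0' → deriv f2 Rb' = s0' →
        f2 Rb' - f1 Ra' = s0' * (Rb' - Ra') →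
        s0' = s0 ∧ Ra' = Ra ∧ Rb' = Rb) ∧
      Ra = w1 * Real.logb 2 (s0 * w1 * h1 / (Real.log 2 * μ1)) ∧
      Rb = w2 * Real.logb 2 (s0 * w2 * h2 / (Real.log 2 * μ2)) ∧
      g s0 = 0 := by
  have hL : 0 < Real.log 2 := Real.log_pos one_lt_two
  set c1 := Real.log 2 * (μ1 / (w1 * h1)) with hc1
  set c2 := Real.log 2 * (μ2 / (w2 * h2)) with hc2
  have hc1pos : 0 < c1 := by positivity
  have hc2pos : 0 < c2 := by positivity
  have hc : c1 < c2 := by rw [hc1, hc2]; gcongr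
  have hm1 : μ1 / h1 = w1 * c1 / Real.log 2 := by rw [hc1]; field_simp
  have hm2 : μ2 / h2 = w2 * c2 / Real.log 2 := by rw [hc2]; field_simp
  have hR1 := fun {s : ℝ} (hs : 0 < s) => mul_logb_two_eq hw1 hμ1 hh1 hs
  have hR2 := fun {s : ℝ} (hs : 0 < s) => mul_logb_two_eq hw2 hμ2 hh2 hs
  rw [← hc1] at hR1
  rw [← hc2] at hR2
  set b := w2 * Real.log c2 - w1 * Real.log c1 with hb
  set K := w2 * c2 - w1 * c1 with hK
  have hgs : ∀ s, 0 < s → (g s = 0 ↔ s * ((w2 - w1) * Real.log s - b - (w2 - w1)) + K = 0) := by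
    intro s hs
    have : g s = (s * ((w2 - w1) * Real.log s - b - (w2 - w1)) + K) / Real.log 2 := by
      rw [hg, hR1 hs, hR2 hs, hm1, hm2, hb, hK]
      ring
    rw [this, div_eq_zero_iff, or_iff_left hL.ne']
  have hlt : ∀ s, 0 < s →
      (w1 * Real.logb 2 (s * w1 * h1 / (Real.log 2 * μ1)) <
        w2 * Real.logb 2 (s * w2 * h2 / (Real.log 2 * μ2)) ↔
          0 < (w2 - w1) * Real.log s - b) := by
    intro s hs
    rw [hR1 hs, hR2 hs, div_lt_div_iff_of_pos_right hL, ← sub_pos, hb]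
    ring_nf
  have htan : ∀ s Ra Rb, 0 < s → deriv f1 Ra = s → deriv f2 Rb = s →
      (f2 Rb - f1 Ra = s * (Rb - Ra) ↔ g s = 0) := by
    intro s Ra Rb hs ha hb
    rw [powerCost_eq_deriv hw1 hf1, powerCost_eq_deriv hw2 hf2, ha, hb, hg,
      ← (deriv_powerCost_eq_iff hw1 hμ1 hh1 hs hf1 Ra).1 ha,
      ← (deriv_powerCost_eq_iff hw2 hμ2 hh2 hs hf2 Rb).1 hb]
    constructor <;> intro H <;> linear_combination -H
  have hGc : c2 * ((w2 - w1) * Real.log c2 - b - (w2 - w1)) + K < 0 := by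
    have h := Real.log_lt_sub_one_of_pos (div_pos hc1pos hc2pos) ((div_lt_one hc2pos).2 hc).ne
    rw [Real.log_div hc1pos.ne' hc2pos.ne'] at h
    have h' : c2 * (Real.log c1 - Real.log c2) < c1 - c2 := by
      calc c2 * (Real.log c1 - Real.log c2) < c2 * (c1 / c2 - 1) := by gcongr
        _ = c1 - c2 := by field_simp
    rw [hb, hK]
    nlinarith [mul_lt_mul_of_pos_left h' hw1]
  obtain ⟨s, hcs, hds, hGs, huniq⟩ := exists_unique_zero_mul_log (sub_pos.2 hw) hc2pos hGc
  have hs : 0 < s := hc2pos.trans hcs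
  have hd1 := (deriv_powerCost_eq_iff hw1 hμ1 hh1 hs hf1 _).2 rfl
  have hd2 := (deriv_powerCost_eq_iff hw2 hμ2 hh2 hs hf2 _).2 rfl
  have hg0 := (hgs s hs).2 hGs
  refine ⟨s, _, _, ⟨hs, ?_, (hlt s hs).2 hds, hd1, hd2, (htan s _ _ hs hd1 hd2).2 hg0⟩, ?_,
    rfl, rfl, hg0⟩
  · rw [hR1 hs]
    have := sub_pos.2 (Real.log_lt_log hc1pos (hc.trans hcs))
    positivity
  · intro t Ra Rb ht _ hab ha hb' he
    have hRa := (deriv_powerCost_eq_iff hw1 hμ1 hh1 ht hf1 Ra).1 ha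
    have hRb := (deriv_powerCost_eq_iff hw2 hμ2 hh2 ht hf2 Rb).1 hb'
    have hts : t = s := huniq t ht ((hlt t ht).1 (hRa ▸ hRb ▸ hab))
      ((hgs t ht).1 ((htan t Ra Rb ht ha hb').1 he))
    subst hts
    exact ⟨rfl, hRa, hRb⟩
end

section
/- Let w1, w2, μ1, μ2, h1, h2 be positive reals with w1 < w2 and μ1/(w1·h1) ≥ μ2/(w2·h2), and define f1(x) = (μ1/h1)·(2^{x/w1} − 1) and f2(x) = (μ2/h2)·(2^{x/w2} − 1). For R > 0, define J(R) := inf{ τ·f1(R1) + (1−τ)·f2(R2) : τ ∈ [0,1], R1 ≥ 0, R2 ≥ 0, τ·R1 + (1−τ)·R2 = R }. Then J(R) = f2(R), and the infimum is attained at τ = 0, R1 = 0, R2 = R. -/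
/-- The set of achievable total power costs when a total rate reward `R` is split between
two users by time-sharing. -/
def timeShareCosts (f1 f2 : ℝ → ℝ) (R : ℝ) : Set ℝ :=
  {y : ℝ | ∃ τ R1 R2 : ℝ, 0 ≤ τ ∧ τ ≤ 1 ∧ 0 ≤ R1 ∧ 0 ≤ R2 ∧
    τ * R1 + (1 - τ) * R2 = R ∧ y = τ * f1 R1 + (1 - τ) * f2 R2}

theorem mul_two_rpow_div_sub_one_anti {w1 w2 x : ℝ} (hw1 : 0 < w1) (hw : w1 ≤ w2) :
    w2 * ((2 : ℝ) ^ (x / w2) - 1) ≤ w1 * ((2 : ℝ) ^ (x / w1) - 1) := by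
  have hw2 : 0 < w2 := hw1.trans_le hw
  have hpos : (0 : ℝ) < 2 ^ (x / w2) := by positivity
  have hb := one_add_mul_self_le_rpow_one_add (s := (2 : ℝ) ^ (x / w2) - 1) (by linarith)
    ((one_le_div hw1).2 hw)
  rw [add_sub_cancel, ← Real.rpow_mul zero_le_two, div_mul_div_cancel₀ hw2.ne'] at hb
  have hm := mul_le_mul_of_nonneg_left hb hw1.le
  have he : w1 * (1 + w2 / w1 * ((2 : ℝ) ^ (x / w2) - 1))
      = w1 + w2 * ((2 : ℝ) ^ (x / w2) - 1) := by
    field_simp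
  linarith

theorem two_rpow_div_convex {w t x y : ℝ} (ht0 : 0 ≤ t) (ht1 : t ≤ 1) :
    (2 : ℝ) ^ ((t * x + (1 - t) * y) / w)
      ≤ t * (2 : ℝ) ^ (x / w) + (1 - t) * (2 : ℝ) ^ (y / w) := by
  have h := convexOn_exp.2 (Set.mem_univ (Real.log 2 * (x / w)))
    (Set.mem_univ (Real.log 2 * (y / w))) ht0 (sub_nonneg.2 ht1) (add_sub_cancel t 1)
  simp only [smul_eq_mul] at h
  simp only [Real.rpow_def_of_pos zero_lt_two]
  have he : Real.log 2 * ((t * x + (1 - t) * y) / w)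
      = t * (Real.log 2 * (x / w)) + (1 - t) * (Real.log 2 * (y / w)) := by
    ring
  rwa [he]

/-- when `w1 < w2` and `μ1/(w1·h1) ≥ μ2/(w2·h2)`, the minimum time-sharing
power cost is `J(R) = f2(R)`, attained at `τ = 0`, `R1 = 0`, `R2 = R`. -/
theorem stmt5 (w1 w2 μ1 μ2 h1 h2 : ℝ)
    (hw1 : 0 < w1) (hw2 : 0 < w2) (hμ1 : 0 < μ1) (hμ2 : 0 < μ2)
    (hh1 : 0 < h1) (hh2 : 0 < h2) (hw : w1 < w2)
    (f1 f2 : ℝ → ℝ)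
    (hf1 : ∀ x, f1 x = μ1 / h1 * ((2 : ℝ) ^ (x / w1) - 1))
    (hf2 : ∀ x, f2 x = μ2 / h2 * ((2 : ℝ) ^ (x / w2) - 1))
    (hcond : μ2 / (w2 * h2) ≤ μ1 / (w1 * h1)) :
    ∀ R : ℝ, 0 < R →
      IsLeast (timeShareCosts f1 f2 R) (f2 R) ∧
      sInf (timeShareCosts f1 f2 R) = (0 : ℝ) * f1 0 + (1 - (0 : ℝ)) * f2 R ∧
      (0 : ℝ) * 0 + (1 - (0 : ℝ)) * R = R := by
  intro R hR
  have hle : ∀ x, 0 ≤ x → f2 x ≤ f1 x := by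
    intro x hx
    have hnn : 0 ≤ w1 * ((2 : ℝ) ^ (x / w1) - 1) :=
      mul_nonneg hw1.le (sub_nonneg.2 (Real.one_le_rpow one_le_two (by positivity)))
    calc f2 x = μ2 / (w2 * h2) * (w2 * ((2 : ℝ) ^ (x / w2) - 1)) := by
          rw [hf2]; field_simp
      _ ≤ μ2 / (w2 * h2) * (w1 * ((2 : ℝ) ^ (x / w1) - 1)) :=
          mul_le_mul_of_nonneg_left (mul_two_rpow_div_sub_one_anti hw1 hw.le) (by positivity)
      _ ≤ μ1 / (w1 * h1) * (w1 * ((2 : ℝ) ^ (x / w1) - 1)) :=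
          mul_le_mul_of_nonneg_right hcond hnn
      _ = f1 x := by rw [hf1]; field_simp
  have hleast : IsLeast (timeShareCosts f1 f2 R) (f2 R) := by
    refine ⟨⟨0, 0, R, le_rfl, zero_le_one, le_rfl, hR.le, by ring, by ring⟩, ?_⟩
    rintro y ⟨τ, R1, R2, hτ0, hτ1, hR1, -, hsum, rfl⟩
    have hconv : f2 R ≤ τ * f2 R1 + (1 - τ) * f2 R2 := by
      have h := mul_le_mul_of_nonneg_left
        (two_rpow_div_convex (w := w2) (x := R1) (y := R2) hτ0 hτ1) (div_pos hμ2 hh2).le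
      rw [hsum] at h
      simp only [hf2]
      linarith
    have := mul_le_mul_of_nonneg_left (hle R1 hR1) hτ0
    linarith
  exact ⟨hleast, by rw [hleast.csInf_eq]; ring, by ring⟩
end

section
/- Let w1, w2, μ1, μ2, h1, h2 be positive reals with w1 < w2 and μ1/(w1·h1) < μ2/(w2·h2), and define f1(x) = (μ1/h1)·(2^{x/w1} − 1) and f2(x) = (μ2/h2)·(2^{x/w2} − 1). Let s0 > 0 and 0 < Ra < Rb be the common-tangent data, i.e. f1'(Ra) = f2'(Rb) = s0 and f2(Rb) − f1(Ra) = s0·(Rb − Ra). For R > 0, define J(R) := inf{ τ·f1(R1) + (1−τ)·f2(R2) : τ ∈ [0,1], R1 ≥ 0, R2 ≥ 0, τ·R1 + (1−τ)·R2 = R }. Then the infimum is attained and: J(R) = f1(R) if 0 < R ≤ Ra; J(R) = f2(R) if R ≥ Rb; and J(R) = f1(Ra) + s0·(R − Ra) if Ra < R < Rb, the last case being attained by τ = (Rb − R)/(Rb − Ra), R1 = Ra, R2 = Rb. -/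
/-- The tangent line of `x ↦ A * (2 ^ (x / w) - 1)` at `x` lies below the graph. -/
theorem tangent_le_two_rpow {A : ℝ} (hA : 0 ≤ A) (w x y : ℝ) :
    A * ((2 : ℝ) ^ (x / w) - 1) + A * (2 ^ (x / w) * Real.log 2 / w) * (y - x)
      ≤ A * ((2 : ℝ) ^ (y / w) - 1) := by
  have hsplit : (2 : ℝ) ^ (y / w) = 2 ^ (x / w) * Real.exp (Real.log 2 * ((y - x) / w)) := by
    rw [← Real.rpow_def_of_pos two_pos, ← Real.rpow_add two_pos]
    congr 1
    ring
  have hexp := Real.add_one_le_exp (Real.log 2 * ((y - x) / w))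
  have hpos : (0 : ℝ) < 2 ^ (x / w) := by positivity
  have hmul := mul_le_mul_of_nonneg_left hexp (mul_nonneg hA hpos.le)
  rw [hsplit]
  calc _ = A * 2 ^ (x / w) * (Real.log 2 * ((y - x) / w) + 1) - A := by ring
    _ ≤ _ := by linarith

theorem hasDerivAt_two_rpow (A w x : ℝ) :
    HasDerivAt (fun x : ℝ => A * ((2 : ℝ) ^ (x / w) - 1))
      (A * (2 ^ (x / w) * Real.log 2 / w)) x := by
  have h := ((((hasDerivAt_id x).div_const w).const_rpow (a := 2) two_pos).sub_const 1).const_mul A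
  exact h.congr_deriv (by rw [id]; ring)

/-- Moving from `y` down to `x` scales the cost with the larger bandwidth by a factor `t`, and
scales the cost with the smaller bandwidth at least as strongly. -/
theorem exists_scale_two_rpow {w1 w2 A1 x y : ℝ} (A2 : ℝ) (hw1 : 0 < w1) (hw : w1 ≤ w2)
    (hA1 : 0 ≤ A1) (hx : 0 < x) (hxy : x ≤ y) :
    ∃ t : ℝ, 0 < t ∧
      A2 * ((2 : ℝ) ^ (x / w2) - 1) = t * (A2 * ((2 : ℝ) ^ (y / w2) - 1)) ∧
      A1 * ((2 : ℝ) ^ (x / w1) - 1) ≤ t * (A1 * ((2 : ℝ) ^ (y / w1) - 1)) := by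
  have hw2 : 0 < w2 := hw1.trans_le hw
  have hu : (1 : ℝ) < 2 ^ (x / w2) := Real.one_lt_rpow one_lt_two (by positivity)
  have huv : (2 : ℝ) ^ (x / w2) ≤ 2 ^ (y / w2) :=
    Real.rpow_le_rpow_of_exponent_le one_le_two (by gcongr)
  have hpow : ∀ z : ℝ, (2 : ℝ) ^ (z / w1) = ((2 : ℝ) ^ (z / w2)) ^ (w2 / w1) := fun z => by
    rw [← Real.rpow_mul two_pos.le]
    congr 1
    field_simp
  rw [hpow x, hpow y]
  generalize (2 : ℝ) ^ (x / w2) = u at *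
  generalize (2 : ℝ) ^ (y / w2) = v at *
  have hv : 0 < v - 1 := by linarith
  have ht : 0 < (u - 1) / (v - 1) := div_pos (by linarith) hv
  have ht1 : (u - 1) / (v - 1) ≤ 1 := (div_le_one hv).2 (by linarith)
  have htv : (u - 1) / (v - 1) * (v - 1) = u - 1 := div_mul_cancel₀ _ hv.ne'
  refine ⟨(u - 1) / (v - 1), ht, by rw [mul_left_comm, htv], ?_⟩
  generalize (u - 1) / (v - 1) = t at *
  have hconv := (convexOn_rpow ((one_le_div hw1).2 hw)).2 (x := 1) (y := v)
    (Set.mem_Ici.2 zero_le_one) (Set.mem_Ici.2 (by linarith)) (sub_nonneg.2 ht1) ht.le (by ring)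
  simp only [smul_eq_mul, Real.one_rpow] at hconv
  rw [show (1 - t) * 1 + t * v = u by linarith] at hconv
  calc A1 * (u ^ (w2 / w1) - 1) ≤ A1 * (t * (v ^ (w2 / w1) - 1)) :=
        mul_le_mul_of_nonneg_left (by linarith) hA1
    _ = _ := by ring

/-- An affine function below both cost functions bounds every time-sharing cost from below. -/
theorem le_of_mem_timeShareCosts {f1 f2 : ℝ → ℝ} {R a s y : ℝ}
    (h1 : ∀ x, 0 ≤ x → a + s * (x - R) ≤ f1 x) (h2 : ∀ x, 0 ≤ x → a + s * (x - R) ≤ f2 x)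
    (hy : y ∈ timeShareCosts f1 f2 R) : a ≤ y := by
  obtain ⟨τ, R1, R2, hτ, hτ1, hR1, hR2, hR, rfl⟩ := hy
  calc a = τ * (a + s * (R1 - R)) + (1 - τ) * (a + s * (R2 - R)) := by
        linear_combination -s * hR
    _ ≤ _ := add_le_add (mul_le_mul_of_nonneg_left (h1 R1 hR1) hτ)
        (mul_le_mul_of_nonneg_left (h2 R2 hR2) (sub_nonneg.2 hτ1))

/-- when `w1 < w2` and `μ1/(w1·h1) < μ2/(w2·h2)`, with common tangent data
`(s0, Ra, Rb)`, the minimum time-sharing power cost is `f1(R)` for `0 < R ≤ Ra`, `f2(R)` for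
`R ≥ Rb`, and `f1(Ra) + s0·(R − Ra)` for `Ra < R < Rb`, the last attained by time-sharing
`τ = (Rb − R)/(Rb − Ra)` between `Ra` and `Rb`. -/
theorem stmt6 (w1 w2 μ1 μ2 h1 h2 : ℝ)
    (hw1 : 0 < w1) (hw2 : 0 < w2) (hμ1 : 0 < μ1) (hμ2 : 0 < μ2)
    (hh1 : 0 < h1) (hh2 : 0 < h2) (hw : w1 < w2)
    (hcond : μ1 / (w1 * h1) < μ2 / (w2 * h2))
    (f1 f2 : ℝ → ℝ)
    (hf1 : ∀ x, f1 x = μ1 / h1 * ((2 : ℝ) ^ (x / w1) - 1))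
    (hf2 : ∀ x, f2 x = μ2 / h2 * ((2 : ℝ) ^ (x / w2) - 1))
    (s0 Ra Rb : ℝ) (hs0 : 0 < s0) (hRa : 0 < Ra) (hRaRb : Ra < Rb)
    (htan1 : deriv f1 Ra = s0) (htan2 : deriv f2 Rb = s0)
    (htan3 : f2 Rb - f1 Ra = s0 * (Rb - Ra)) :
    ∀ R : ℝ, 0 < R →
      (R ≤ Ra → IsLeast (timeShareCosts f1 f2 R) (f1 R)) ∧
      (Rb ≤ R → IsLeast (timeShareCosts f1 f2 R) (f2 R)) ∧
      (Ra < R → R < Rb →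
        IsLeast (timeShareCosts f1 f2 R) (f1 Ra + s0 * (R - Ra)) ∧
        0 ≤ (Rb - R) / (Rb - Ra) ∧ (Rb - R) / (Rb - Ra) ≤ 1 ∧
        (Rb - R) / (Rb - Ra) * Ra + (1 - (Rb - R) / (Rb - Ra)) * Rb = R ∧
        (Rb - R) / (Rb - Ra) * f1 Ra + (1 - (Rb - R) / (Rb - Ra)) * f2 Rb
          = f1 Ra + s0 * (R - Ra)) := by
  intro R hR
  have hA1 : 0 ≤ μ1 / h1 := by positivity
  have hA2 : 0 ≤ μ2 / h2 := by positivity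
  have hd1 : ∀ x, deriv f1 x = μ1 / h1 * (2 ^ (x / w1) * Real.log 2 / w1) := fun x => by
    rw [funext hf1]
    exact (hasDerivAt_two_rpow _ _ _).deriv
  have hd2 : ∀ x, deriv f2 x = μ2 / h2 * (2 ^ (x / w2) * Real.log 2 / w2) := fun x => by
    rw [funext hf2]
    exact (hasDerivAt_two_rpow _ _ _).deriv
  have htl1 : ∀ x y, f1 x + deriv f1 x * (y - x) ≤ f1 y := fun x y => by
    rw [hd1, hf1, hf1]
    exact tangent_le_two_rpow hA1 _ _ _
  have htl2 : ∀ x y, f2 x + deriv f2 x * (y - x) ≤ f2 y := fun x y => by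
    rw [hd2, hf2, hf2]
    exact tangent_le_two_rpow hA2 _ _ _
  have hlog : 0 < Real.log 2 := Real.log_pos one_lt_two
  have hmono1 : ∀ x y, x ≤ y → deriv f1 x ≤ deriv f1 y := fun x y hxy => by
    rw [hd1, hd1]
    gcongr
    exact one_le_two
  have hmono2 : ∀ x y, x ≤ y → deriv f2 x ≤ deriv f2 y := fun x y hxy => by
    rw [hd2, hd2]
    gcongr
    exact one_le_two
  have hscale : ∀ x y, 0 < x → x ≤ y → ∃ t, 0 < t ∧ f2 x = t * f2 y ∧ f1 x ≤ t * f1 y :=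
    fun x y hx hxy => by
      simp only [hf1, hf2]
      exact exists_scale_two_rpow _ hw1 hw.le hA1 hx hxy
  have hline1 : ∀ x, f1 Ra + s0 * (x - Ra) ≤ f1 x := fun x => htan1 ▸ htl1 Ra x
  have hline2 : ∀ x, f1 Ra + s0 * (x - Ra) ≤ f2 x := fun x => by
    have h := htl2 Rb x
    rw [htan2] at h
    linarith
  refine ⟨fun hRRa => ⟨⟨1, R, 0, zero_le_one, le_rfl, hR.le, le_rfl, by ring, by ring⟩,
      fun y hy => ?_⟩,
    fun hRbR => ⟨⟨0, 0, R, le_rfl, zero_le_one, le_rfl, hR.le, by ring, by ring⟩,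
      fun y hy => ?_⟩, fun hRaR hRRb => ?_⟩
  · refine le_of_mem_timeShareCosts (s := deriv f1 R) (fun x _ => htl1 R x) (fun x hx => ?_) hy
    rcases le_total x Ra with hxa | hxa
    · refine (htl1 R x).trans ?_
      rcases hx.eq_or_lt with rfl | hx
      · simp [hf1, hf2]
      · obtain ⟨t, ht, h2, h1⟩ := hscale x Ra hx hxa
        rw [h2]
        refine h1.trans (mul_le_mul_of_nonneg_left ?_ ht.le)
        simpa using hline2 Ra
    · have hs : deriv f1 R * (x - Ra) ≤ s0 * (x - Ra) :=
        mul_le_mul_of_nonneg_right (htan1 ▸ hmono1 R Ra hRRa) (sub_nonneg.2 hxa)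
      linarith [htl1 R Ra, hline2 x]
  · refine le_of_mem_timeShareCosts (s := deriv f2 R) (fun x hx => ?_) (fun x _ => htl2 R x) hy
    rcases le_total Rb x with hxb | hxb
    · refine (htl2 R x).trans ?_
      obtain ⟨t, ht, h2, h1⟩ := hscale Rb x (hRa.trans hRaRb) hxb
      refine le_of_mul_le_mul_left ?_ ht
      linarith [hline1 Rb]
    · have hs : s0 * (Rb - x) ≤ deriv f2 R * (Rb - x) :=
        mul_le_mul_of_nonneg_right (htan2 ▸ hmono2 Rb R hRbR) (sub_nonneg.2 hxb)
      linarith [htl2 R Rb, hline1 x]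
  · have hab : 0 < Rb - Ra := sub_pos.2 hRaRb
    have hτ : 0 ≤ (Rb - R) / (Rb - Ra) := div_nonneg (by linarith) hab.le
    have hτ1 : (Rb - R) / (Rb - Ra) ≤ 1 := (div_le_one hab).2 (by linarith)
    have hτab : (Rb - R) / (Rb - Ra) * (Rb - Ra) = Rb - R := div_mul_cancel₀ _ hab.ne'
    generalize (Rb - R) / (Rb - Ra) = τ at *
    have hrate : τ * Ra + (1 - τ) * Rb = R := by linear_combination -hτab
    have hcost : τ * f1 Ra + (1 - τ) * f2 Rb = f1 Ra + s0 * (R - Ra) := by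
      linear_combination (1 - τ) * htan3 - s0 * hτab
    refine ⟨⟨⟨τ, Ra, Rb, hτ, hτ1, hRa.le, (hRa.trans hRaRb).le, hrate, hcost.symm⟩,
      fun y hy => ?_⟩, hτ, hτ1, hrate, hcost⟩
    exact le_of_mem_timeShareCosts (s := s0) (fun x _ => by linarith [hline1 x])
      (fun x _ => by linarith [hline2 x]) hy
end

section
/- Let f1, …, fK : [0,∞) → ℝ be given by f_k(x) = (μ_k/h_k)·(2^{x/w_k} − 1) with all μ_k, h_k, w_k > 0, and set f̄(x) := min_{1 ≤ k ≤ K} f_k(x). Then for every R ≥ 0 there exist Ra ≥ 0, Rb ≥ 0 and τ ∈ [0,1] such that τ·Ra + (1−τ)·Rb = R and τ·f̄(Ra) + (1−τ)·f̄(Rb) = f̄^c(R), where f̄^c is the convex envelope of f̄ on [0,∞). -/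
/-- The convex envelope on `[0,∞)` of `f`: the pointwise supremum of all affine functions
lying below `f` on `[0,∞)`. -/
noncomputable def convexEnvelope (f : ℝ → ℝ) (x : ℝ) : ℝ :=
  sSup {v : ℝ | ∃ a b : ℝ, v = a * x + b ∧ ∀ y : ℝ, 0 ≤ y → a * y + b ≤ f y}

open Set Filter Topology

/-- If `f` lies above an affine function on `[0,∞)` that it touches at two points, then the convex
envelope of `f` is that affine function between the two points. -/
lemma convexEnvelope_eq_of_touching {f : ℝ → ℝ} {a b y₁ y₂ τ : ℝ}
    (hab : ∀ z, 0 ≤ z → a * z + b ≤ f z) (h₁ : 0 ≤ y₁) (h₂ : 0 ≤ y₂)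
    (hf₁ : f y₁ = a * y₁ + b) (hf₂ : f y₂ = a * y₂ + b) (hτ₀ : 0 ≤ τ) (hτ₁ : τ ≤ 1) :
    convexEnvelope f (τ * y₁ + (1 - τ) * y₂) = τ * f y₁ + (1 - τ) * f y₂ := by
  refine IsGreatest.csSup_eq ⟨⟨a, b, ?_, hab⟩, ?_⟩
  · rw [hf₁, hf₂]; ring
  · rintro v ⟨a', b', rfl, h'⟩
    have e₁ := mul_le_mul_of_nonneg_left (h' y₁ h₁) hτ₀
    have e₂ := mul_le_mul_of_nonneg_left (h' y₂ h₂) (sub_nonneg.2 hτ₁)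
    linarith

/-- The slopes in a compact interval for which `f z - a * z` has a minimizer over `[0,∞)` lying in
a given compact interval form a closed set. -/
lemma isClosed_slopes_with_minimizer {f : ℝ → ℝ} (hf : Continuous f) (m M p q : ℝ) :
    IsClosed {a | a ∈ Icc m M ∧ ∃ y ∈ Icc p q, ∀ z, 0 ≤ z → f y - a * y ≤ f z - a * z} := by
  have hc : IsClosed {x : ℝ × ℝ | ∀ z, 0 ≤ z → f x.2 - x.1 * x.2 ≤ f z - x.1 * z} := by
    simp only [ofPred_forall]
    exact isClosed_iInter fun z => isClosed_iInter fun _ =>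
      isClosed_le (by fun_prop) (by fun_prop)
  convert ((((isCompact_Icc (a := m) (b := M)).prod (isCompact_Icc (a := p) (b := q))).inter_right
    hc).image continuous_fst).isClosed using 1
  ext a
  constructor
  · rintro ⟨ha, y, hy, h⟩
    exact ⟨(a, y), ⟨⟨ha, hy⟩, h⟩, rfl⟩
  · rintro ⟨⟨a, y⟩, ⟨⟨ha, hy⟩, h⟩, rfl⟩
    exact ⟨ha, y, hy, h⟩

/-- A continuous, nonnegative, superlinear function vanishing at `0` has, for every `R ≥ 0`, a
slope `a` such that `f z - a * z` has minimizers over `[0,∞)` on both sides of `R`. -/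
lemma exists_slope_with_minimizers_both_sides {f : ℝ → ℝ} (hf : Continuous f) (hf₀ : f 0 = 0)
    (hpos : ∀ y, 0 ≤ y → 0 ≤ f y) (hsup : ∀ M : ℝ, ∀ᶠ y in atTop, M * y < f y)
    {R : ℝ} (hR : 0 ≤ R) :
    ∃ a, (∃ y ∈ Icc 0 R, ∀ z, 0 ≤ z → f y - a * y ≤ f z - a * z) ∧
      ∃ y, R ≤ y ∧ ∀ z, 0 ≤ z → f y - a * y ≤ f z - a * z := by
  set M := f (R + 1) + 1 with hM
  have hM₀ : 0 ≤ M := by have := hpos (R + 1) (by linarith); linarith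
  obtain ⟨N, hN⟩ := eventually_atTop.1 (hsup M)
  have hmin : ∀ a ∈ Icc 0 M, ∃ y ∈ Icc 0 (max N R), ∀ z, 0 ≤ z → f y - a * y ≤ f z - a * z := by
    rintro a ⟨-, haM⟩
    obtain ⟨y, hy, hmy⟩ := (isCompact_Icc (a := (0 : ℝ)) (b := max N R)).exists_isMinOn
      ⟨0, by simp [hR]⟩ (f := fun y => f y - a * y) (by fun_prop)
    refine ⟨y, hy, fun z hz => ?_⟩
    rcases le_total z (max N R) with h | h
    · exact hmy ⟨hz, h⟩
    · have h0 : f y - a * y ≤ f 0 - a * 0 := hmy ⟨le_rfl, by simp [hR]⟩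
      have := hN z ((le_max_left _ _).trans h)
      have := mul_le_mul_of_nonneg_right haM hz
      linarith
  have hA := isClosed_slopes_with_minimizer hf 0 M 0 R
  have hB := isClosed_slopes_with_minimizer hf 0 M R (max N R)
  have hzero : (0 : ℝ) ∈ Icc 0 M := ⟨le_rfl, hM₀⟩
  obtain ⟨a, -, ⟨-, hy₁⟩, -, y₂, hy₂, h₂⟩ := isPreconnected_closed_iff.1
    (isPreconnected_Icc (a := (0 : ℝ)) (b := M)) _ _ hA hB
    (by
      intro a ha
      obtain ⟨y, hy, h⟩ := hmin a ha
      rcases le_total y R with hyR | hyR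
      · exact Or.inl ⟨ha, y, ⟨hy.1, hyR⟩, h⟩
      · exact Or.inr ⟨ha, y, ⟨hyR, hy.2⟩, h⟩)
    ⟨0, hzero, hzero, 0, ⟨le_rfl, hR⟩, fun z hz => by simpa [hf₀] using hpos z hz⟩
    (by
      have hMM : M ∈ Icc 0 M := ⟨hM₀, le_rfl⟩
      obtain ⟨y, hy, h⟩ := hmin M hMM
      refine ⟨M, hMM, hMM, y, ⟨?_, hy.2⟩, h⟩
      by_contra! hyR
      have h1 := h (R + 1) (by linarith)
      have h2 := hpos y hy.1
      have h3 := mul_le_mul_of_nonneg_left hyR.le hM₀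
      linarith)
  exact ⟨a, hy₁, y₂, hy₂.1, h₂⟩

/-- Every point of the convex envelope of a continuous, nonnegative, superlinear function vanishing
at `0` is a convex combination of two points on its graph. -/
lemma exists_convex_combination_eq_convexEnvelope {f : ℝ → ℝ} (hf : Continuous f) (hf₀ : f 0 = 0)
    (hpos : ∀ y, 0 ≤ y → 0 ≤ f y) (hsup : ∀ M : ℝ, ∀ᶠ y in atTop, M * y < f y)
    {R : ℝ} (hR : 0 ≤ R) :
    ∃ Ra Rb τ : ℝ, 0 ≤ Ra ∧ 0 ≤ Rb ∧ 0 ≤ τ ∧ τ ≤ 1 ∧ τ * Ra + (1 - τ) * Rb = R ∧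
      τ * f Ra + (1 - τ) * f Rb = convexEnvelope f R := by
  obtain ⟨a, ⟨y₁, hy₁, h₁⟩, y₂, hy₂, h₂⟩ :=
    exists_slope_with_minimizers_both_sides hf hf₀ hpos hsup hR
  have hy₂' : 0 ≤ y₂ := hR.trans hy₂
  obtain ⟨τ, σ, hτ, hσ, hτσ, hcomb⟩ : R ∈ segment ℝ y₁ y₂ := by
    rw [segment_eq_Icc (hy₁.2.trans hy₂)]; exact ⟨hy₁.2, hy₂⟩
  obtain rfl : σ = 1 - τ := by linarith
  simp only [smul_eq_mul] at hcomb
  have heq : f y₁ - a * y₁ = f y₂ - a * y₂ := le_antisymm (h₁ y₂ hy₂') (h₂ y₁ hy₁.1)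
  refine ⟨y₁, y₂, τ, hy₁.1, hy₂', hτ, by linarith, hcomb, ?_⟩
  rw [← hcomb]
  exact (convexEnvelope_eq_of_touching (a := a) (b := f y₁ - a * y₁)
    (fun z hz => by linarith [h₁ z hz]) hy₁.1 hy₂' (by ring) (by linarith) hτ (by linarith)).symm

/-- The curve `x ↦ c * (2 ^ (x / w) - 1)` grows superlinearly. -/
lemma eventually_mul_lt_mul_two_rpow_sub_one {c w : ℝ} (hc : 0 < c) (hw : 0 < w) (M : ℝ) :
    ∀ᶠ y in atTop, M * y < c * ((2 : ℝ) ^ (y / w) - 1) := by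
  have hL : 0 < Real.log 2 / w := div_pos (Real.log_pos one_lt_two) hw
  set L := Real.log 2 / w
  filter_upwards [eventually_gt_atTop (2 * M / (c * L ^ 2)), eventually_gt_atTop 0] with y hy hy₀
  rw [div_lt_iff₀ (by positivity)] at hy
  have hexp : (2 : ℝ) ^ (y / w) = Real.exp (L * y) := by
    rw [Real.rpow_def_of_pos two_pos]; congr 1; ring
  have hq := Real.quadratic_le_exp_of_nonneg (x := L * y) (by positivity)
  rw [hexp]
  have hLy : 0 < L * y := by positivity
  have h1 : c * ((L * y) ^ 2 / 2) ≤ c * (Real.exp (L * y) - 1) :=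
    mul_le_mul_of_nonneg_left (by linarith) hc.le
  have h2 := mul_lt_mul_of_pos_right hy hy₀
  linarith

/-- every point of the convex envelope of the pointwise minimum
`f̄(x) = min_k f_k(x)` of the `K` power-cost∼rate-reward curves is a convex combination of
two points on the graph of `f̄`. -/
theorem stmt8 (K : ℕ) (hK : 1 ≤ K)
    (μ h w : Fin K → ℝ)
    (hμ : ∀ k, 0 < μ k) (hh : ∀ k, 0 < h k) (hw : ∀ k, 0 < w k)
    (f : Fin K → ℝ → ℝ)
    (hf : ∀ k x, f k x = μ k / h k * ((2 : ℝ) ^ (x / w k) - 1))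
    (fbar : ℝ → ℝ) (hfbar : ∀ x, fbar x = ⨅ k, f k x) :
    ∀ R : ℝ, 0 ≤ R →
      ∃ Ra Rb τ : ℝ, 0 ≤ Ra ∧ 0 ≤ Rb ∧ 0 ≤ τ ∧ τ ≤ 1 ∧
        τ * Ra + (1 - τ) * Rb = R ∧
        τ * fbar Ra + (1 - τ) * fbar Rb = convexEnvelope fbar R := by
  intro R hR
  have : Nonempty (Fin K) := ⟨⟨0, hK⟩⟩
  have hattained : ∀ x, ∃ k, f k x = fbar x := fun x => by
    rw [hfbar]; exact exists_eq_ciInf_of_finite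
  refine exists_convex_combination_eq_convexEnvelope ?_ ?_ (fun y hy => ?_) (fun M => ?_) hR
  · have hfc : ∀ k, Continuous (f k) := fun k => by
      rw [funext (hf k)]
      exact continuous_const.mul (((Real.continuous_const_rpow two_ne_zero).comp
        (continuous_id.div_const _)).sub continuous_const)
    have : fbar = fun x => Finset.univ.inf' Finset.univ_nonempty fun k => f k x := by
      funext x; rw [hfbar, Finset.inf'_univ_eq_ciInf]
    rw [this]
    exact Continuous.finset_inf'_apply _ fun k _ => hfc k
  · obtain ⟨k, hk⟩ := hattained 0
    rw [← hk, hf]; simp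
  · obtain ⟨k, hk⟩ := hattained y
    rw [← hk, hf]
    exact mul_nonneg (div_pos (hμ k) (hh k)).le (sub_nonneg.2
      (Real.one_le_rpow one_le_two (div_nonneg hy (hw k).le)))
  · filter_upwards [eventually_all.2 fun k =>
      eventually_mul_lt_mul_two_rpow_sub_one (div_pos (hμ k) (hh k)) (hw k) M] with y hy
    obtain ⟨k, hk⟩ := hattained y
    rw [← hk, hf]
    exact hy k
end

section
/- Let f1, …, fK : [0,∞) → ℝ be given by f_k(x) = (μ_k/h_k)·(2^{x/w_k} − 1) with all μ_k, h_k, w_k > 0, and set f̄(x) := min_{1 ≤ k ≤ K} f_k(x). For R > 0 define J_K(R) := inf{ ∑_{k=1}^K τ_k·f_k(R_k) : τ_k ≥ 0, ∑_{k=1}^K τ_k = 1, R_k ≥ 0 for all k, ∑_{k=1}^K τ_k·R_k = R }. Then J_K(R) = f̄^c(R), where f̄^c is the convex envelope of f̄ on [0,∞); moreover the infimum is attained by an allocation in which at most two of the τ_k are nonzero, i.e. there exist indices i, j, a number τ ∈ [0,1], and Ra, Rb ≥ 0 with τ·Ra + (1−τ)·Rb = R and τ·f_i(Ra) + (1−τ)·f_j(Rb)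 = f̄^c(R). -/
/-- A nonnegative superlinear continuous function vanishing at `0` has, over each `R > 0`, an affine
minorant on `[0,∞)` touching it on both sides of `R`. -/
theorem exists_affine_minorant_touching {g : ℝ → ℝ} (hc : Continuous g) (h0 : g 0 = 0)
    (hnn : ∀ y, 0 ≤ y → 0 ≤ g y) (hsup : ∀ a : ℝ, ∃ M, ∀ y, M ≤ y → a * y ≤ g y)
    {R : ℝ} (hR : 0 < R) :
    ∃ a b x₁ x₂ : ℝ, 0 ≤ x₁ ∧ x₁ ≤ R ∧ R ≤ x₂ ∧ (∀ y, 0 ≤ y → a * y + b ≤ g y) ∧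
      g x₁ = a * x₁ + b ∧ g x₂ = a * x₂ + b := by
  set s := g (R + 1) with hs
  have hs0 : 0 ≤ s := hnn _ (by linarith)
  obtain ⟨M₀, hM₀⟩ := hsup s
  set M := max M₀ (R + 1) with hM
  have hMR : R + 1 ≤ M := le_max_right _ _
  have hbig : ∀ y, M ≤ y → s * y ≤ g y := fun y hy => hM₀ y ((le_max_left _ _).trans hy)
  let P : Set (ℝ × ℝ) := {p | ∀ y, 0 ≤ y → g p.1 - p.2 * p.1 ≤ g y - p.2 * y}
  have hP : IsClosed P := by
    simp only [P, Set.ofPred_forall]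
    refine isClosed_iInter fun y => isClosed_iInter fun _ => isClosed_le ?_ ?_ <;> fun_prop
  have himage (l u : ℝ) : IsClosed (Prod.snd '' ((Set.Icc l u ×ˢ Set.Icc 0 s) ∩ P)) :=
    (((isCompact_Icc.prod isCompact_Icc).inter_right hP).image continuous_snd).isClosed
  have hmin : ∀ a ∈ Set.Icc 0 s, ∃ x ∈ Set.Icc 0 M, (x, a) ∈ P := by
    intro a ha
    obtain ⟨x, hx, hxm⟩ := isCompact_Icc.exists_isMinOn (s := Set.Icc 0 M)
      ⟨0, le_rfl, by linarith⟩ (f := fun x => g x - a * x) (by fun_prop)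
    refine ⟨x, hx, fun y hy => ?_⟩
    rcases le_total y M with h | h
    · exact hxm (show y ∈ Set.Icc 0 M from ⟨hy, h⟩)
    · have h₁ : g x - a * x ≤ g 0 - a * 0 := hxm (show (0 : ℝ) ∈ Set.Icc 0 M from ⟨le_rfl, by linarith⟩)
      have h₂ := hbig y h
      have h₃ := mul_le_mul_of_nonneg_right ha.2 hy
      simp only
      linarith
  have hinter := isPreconnected_closed_iff.1 (isPreconnected_Icc (a := (0 : ℝ)) (b := s))
    _ _ (himage 0 R) (himage R M) ?_ ?_ ?_
  · obtain ⟨a, -, ⟨⟨x₁, _⟩, ⟨⟨hx₁, -⟩, hm₁⟩, rfl⟩, ⟨⟨x₂, a⟩, ⟨⟨hx₂, -⟩, hm₂⟩, rfl⟩⟩ := hinter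
    have hx₁' : 0 ≤ x₁ ∧ x₁ ≤ R := hx₁
    have hx₂' : R ≤ x₂ ∧ x₂ ≤ M := hx₂
    have h₁ : ∀ y, 0 ≤ y → g x₁ - a * x₁ ≤ g y - a * y := hm₁
    have h₂ : ∀ y, 0 ≤ y → g x₂ - a * x₂ ≤ g y - a * y := hm₂
    refine ⟨a, g x₁ - a * x₁, x₁, x₂, hx₁'.1, hx₁'.2, hx₂'.1, fun y hy => ?_, by ring, ?_⟩
    · linarith [h₁ y hy]
    · linarith [h₁ x₂ (by linarith), h₂ x₁ hx₁'.1]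
  · intro a ha
    obtain ⟨x, hx, hxP⟩ := hmin a ha
    rcases le_total x R with h | h
    · exact Or.inl ⟨(x, a), ⟨⟨⟨hx.1, h⟩, ha⟩, hxP⟩, rfl⟩
    · exact Or.inr ⟨(x, a), ⟨⟨⟨h, hx.2⟩, ha⟩, hxP⟩, rfl⟩
  · refine ⟨0, ⟨le_rfl, hs0⟩, (0, 0), ⟨⟨⟨le_rfl, hR.le⟩, ⟨le_rfl, hs0⟩⟩, fun y hy => ?_⟩, rfl⟩
    simpa [h0] using hnn y hy
  · have hsm : s ∈ Set.Icc 0 s := ⟨hs0, le_rfl⟩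
    refine ⟨s, hsm, ?_⟩
    obtain ⟨x, hx, hxP⟩ := hmin s hsm
    rcases le_total R x with h | h
    · exact ⟨(x, s), ⟨⟨⟨h, hx.2⟩, hsm⟩, hxP⟩, rfl⟩
    · refine ⟨(R + 1, s), ⟨⟨⟨by linarith, hMR⟩, hsm⟩, fun y hy => ?_⟩, rfl⟩
      have h₁ : g x - s * x ≤ g y - s * y := hxP y hy
      have h₂ := hnn x hx.1
      have h₃ := mul_le_mul_of_nonneg_left h hs0
      simp only
      linarith

/-- `c * (2 ^ (x / w) - 1)` eventually dominates every linear function. -/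
theorem exists_forall_mul_le_exponential_cost {c w : ℝ} (hc : 0 < c) (hw : 0 < w) (a : ℝ) :
    ∃ M, ∀ y, M ≤ y → a * y ≤ c * ((2 : ℝ) ^ (y / w) - 1) := by
  have hl : 0 < Real.log 2 := Real.log_pos one_lt_two
  set d := Real.log 2 / w with hd
  have hd0 : 0 < d := div_pos hl hw
  refine ⟨max 0 (2 * a / (c * d ^ 2)), fun y hy => ?_⟩
  have hy0 : 0 ≤ y := (le_max_left _ _).trans hy
  have hya : 2 * a ≤ y * (c * d ^ 2) :=
    (div_le_iff₀ (by positivity)).1 ((le_max_right _ _).trans hy)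
  have he : (2 : ℝ) ^ (y / w) = Real.exp (d * y) := by
    rw [Real.rpow_def_of_pos two_pos, hd]
    congr 1
    ring
  have hq := Real.quadratic_le_exp_of_nonneg (mul_nonneg hd0.le hy0)
  rw [he]
  calc a * y ≤ c * ((d * y) ^ 2 / 2) := by nlinarith
    _ ≤ c * (Real.exp (d * y) - 1) := by
      have := mul_nonneg hd0.le hy0
      gcongr
      linarith

/-- The power cost `c * (2 ^ (x / w) - 1)` is convex. -/
theorem convexOn_exponential_cost {c : ℝ} (hc : 0 ≤ c) (w : ℝ) :
    ConvexOn ℝ Set.univ fun x : ℝ => c * ((2 : ℝ) ^ (x / w) - 1) := by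
  have h₁ := (convexOn_rpow_left (b := 2) two_pos).comp_linearMap
    ((w⁻¹ : ℝ) • (LinearMap.id : ℝ →ₗ[ℝ] ℝ))
  have h₂ := (h₁.add_const (-1)).smul hc
  refine h₂.congr fun x _ => ?_
  simp [div_eq_inv_mul, sub_eq_add_neg]

/-- The convex envelope agrees with an affine minorant at a convex combination of points where
the minorant is attained. -/
theorem convexEnvelope_eq_of_touching_s9 {g : ℝ → ℝ} {a b t x₁ x₂ R : ℝ}
    (hg : ∀ y, 0 ≤ y → a * y + b ≤ g y) (hx₁ : 0 ≤ x₁) (hx₂ : 0 ≤ x₂) (ht₀ : 0 ≤ t) (ht₁ : t ≤ 1)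
    (h₁ : g x₁ = a * x₁ + b) (h₂ : g x₂ = a * x₂ + b) (hR : t * x₁ + (1 - t) * x₂ = R) :
    convexEnvelope g R = a * R + b := by
  refine IsGreatest.csSup_eq ⟨⟨a, b, rfl, hg⟩, ?_⟩
  rintro _ ⟨a', b', rfl, h⟩
  have e₁ := mul_le_mul_of_nonneg_left ((h x₁ hx₁).trans_eq h₁) ht₀
  have e₂ := mul_le_mul_of_nonneg_left ((h x₂ hx₂).trans_eq h₂) (sub_nonneg.2 ht₁)
  subst hR
  linarith

/-- the minimum `K`-user time-sharing power cost `J_K(R)` equals the convex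
envelope of `f̄(x) = min_k f_k(x)`, and the infimum is attained by an allocation with at most
two nonzero time fractions. -/
theorem stmt9 (K : ℕ) (hK : 1 ≤ K)
    (μ h w : Fin K → ℝ)
    (hμ : ∀ k, 0 < μ k) (hh : ∀ k, 0 < h k) (hw : ∀ k, 0 < w k)
    (f : Fin K → ℝ → ℝ)
    (hf : ∀ k x, f k x = μ k / h k * ((2 : ℝ) ^ (x / w k) - 1))
    (fbar : ℝ → ℝ) (hfbar : ∀ x, fbar x = ⨅ k, f k x) :
    ∀ R : ℝ, 0 < R →
      sInf {y : ℝ | ∃ τ r : Fin K → ℝ, (∀ k, 0 ≤ τ k) ∧ (∑ k, τ k) = 1 ∧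
          (∀ k, 0 ≤ r k) ∧ (∑ k, τ k * r k) = R ∧ y = ∑ k, τ k * f k (r k)}
        = convexEnvelope fbar R ∧
      ∃ (i j : Fin K) (τ Ra Rb : ℝ), 0 ≤ τ ∧ τ ≤ 1 ∧ 0 ≤ Ra ∧ 0 ≤ Rb ∧
        τ * Ra + (1 - τ) * Rb = R ∧
        τ * f i Ra + (1 - τ) * f j Rb = convexEnvelope fbar R := by
  intro R hR
  have : Nonempty (Fin K) := ⟨⟨0, hK⟩⟩
  have hc : ∀ k, 0 < μ k / h k := fun k => div_pos (hμ k) (hh k)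
  have hf' : ∀ k, f k = fun x => μ k / h k * ((2 : ℝ) ^ (x / w k) - 1) := fun k => funext (hf k)
  have hle : ∀ k x, fbar x ≤ f k x := fun k x =>
    (hfbar x).trans_le (ciInf_le (Set.finite_range _).bddBelow k)
  have hatt : ∀ x, ∃ k, f k x = fbar x := fun x => by
    rw [hfbar]
    exact exists_eq_ciInf_of_finite
  have hcont : Continuous fbar := by
    have : fbar = fun x => Finset.univ.inf' Finset.univ_nonempty fun k => f k x := by
      funext x
      rw [hfbar, Finset.inf'_univ_eq_ciInf]
    rw [this]
    refine Continuous.finset_inf'_apply _ fun k _ => ?_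
    rw [hf']
    exact continuous_const.mul
      (((Real.continuous_const_rpow two_ne_zero).comp (continuous_id.div_const _)).sub continuous_const)
  have hfbar0 : fbar 0 = 0 := by
    obtain ⟨k, hk⟩ := hatt 0
    simp [← hk, hf]
  have hnn : ∀ y, 0 ≤ y → 0 ≤ fbar y := fun y hy => by
    obtain ⟨k, hk⟩ := hatt y
    rw [← hk, hf]
    exact mul_nonneg (hc k).le
      (sub_nonneg.2 (Real.one_le_rpow one_le_two (div_nonneg hy (hw k).le)))
  have hsup : ∀ a : ℝ, ∃ M, ∀ y, M ≤ y → a * y ≤ fbar y := fun a => by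
    choose M hM using fun k => exists_forall_mul_le_exponential_cost (hc k) (hw k) a
    obtain ⟨N, hN⟩ := (Set.finite_range M).bddAbove
    refine ⟨N, fun y hy => ?_⟩
    obtain ⟨k, hk⟩ := hatt y
    rw [← hk, hf]
    exact hM k y ((hN ⟨k, rfl⟩).trans hy)
  obtain ⟨a, b, x₁, x₂, hx₁, hx₁R, hRx₂, hmin, ht₁, ht₂⟩ :=
    exists_affine_minorant_touching hcont hfbar0 hnn hsup hR
  have hx₂ : 0 ≤ x₂ := hR.le.trans hRx₂
  obtain ⟨t, ht0, ht1, htR⟩ : ∃ t : ℝ, 0 ≤ t ∧ t ≤ 1 ∧ t * x₁ + (1 - t) * x₂ = R := by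
    have hseg : R ∈ segment ℝ x₁ x₂ := by
      rw [segment_eq_Icc (hx₁R.trans hRx₂)]
      exact ⟨hx₁R, hRx₂⟩
    obtain ⟨t, u, ht, hu, htu, rfl⟩ := hseg
    obtain rfl : u = 1 - t := by linarith
    exact ⟨t, ht, by linarith, rfl⟩
  obtain ⟨i, hi⟩ := hatt x₁
  obtain ⟨j, hj⟩ := hatt x₂
  have hval : t * f i x₁ + (1 - t) * f j x₂ = a * R + b := by
    rw [hi, hj, ht₁, ht₂, ← htR]
    ring
  rw [convexEnvelope_eq_of_touching_s9 hmin hx₁ hx₂ ht0 ht1 ht₁ ht₂ htR]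
  refine ⟨IsLeast.csInf_eq ⟨?_, ?_⟩, i, j, t, x₁, x₂, ht0, ht1, hx₁, hx₂, htR, hval⟩
  · rcases eq_or_ne i j with rfl | hij
    · refine ⟨Pi.single i 1, fun _ => R, fun k => ?_, by simp, fun _ => hR.le,
        by simp [← Finset.sum_mul], ?_⟩
      · by_cases hk : k = i <;> simp [hk]
      · have hconv : f i R ≤ t * f i x₁ + (1 - t) * f i x₂ := by
          have := (convexOn_exponential_cost (hc i).le (w i)).2 (Set.mem_univ x₁) (Set.mem_univ x₂)
            ht0 (sub_nonneg.2 ht1) (by ring)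
          simpa only [smul_eq_mul, htR, ← hf] using this
        have hlow := (hmin R hR.le).trans (hle i R)
        simp only [Pi.single_apply, ite_mul, one_mul, zero_mul, Finset.sum_ite_eq',
          Finset.mem_univ, if_true]
        linarith
    · have hsum : ∀ φ : Fin K → ℝ, ∑ k, (Pi.single (M := fun _ => ℝ) i t k +
          Pi.single (M := fun _ => ℝ) j (1 - t) k) * φ k = t * φ i + (1 - t) * φ j := fun φ => by
        simp [add_mul, Finset.sum_add_distrib, Pi.single_apply]
      refine ⟨fun k => Pi.single (M := fun _ => ℝ) i t k + Pi.single (M := fun _ => ℝ) j (1 - t) k,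
        fun k => if k = j then x₂ else x₁, fun k => ?_, ?_, fun k => ?_, ?_, ?_⟩
      · have : 0 ≤ 1 - t := sub_nonneg.2 ht1
        simp only [Pi.single_apply]
        split_ifs <;> linarith
      · simp [Finset.sum_add_distrib]
      · dsimp only
        split_ifs <;> assumption
      · exact (hsum fun k => if k = j then x₂ else x₁).trans (by simp [hij, htR])
      · exact ((hsum fun k => f k (if k = j then x₂ else x₁)).trans (by simp [hij, hval])).symm
  · rintro _ ⟨τ, r, hτ, hτ1, hr, hrR, rfl⟩
    calc a * R + b = ∑ k, τ k * (a * r k + b) := by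
          simp only [mul_add, Finset.sum_add_distrib, ← Finset.sum_mul, hτ1, one_mul, ← hrR,
            Finset.mul_sum, mul_left_comm]
      _ ≤ ∑ k, τ k * f k (r k) := Finset.sum_le_sum fun k _ =>
          mul_le_mul_of_nonneg_left ((hmin _ (hr k)).trans (hle k _)) (hτ k)
end

section
/- Fix positive reals w1 < w2, μ1, μ2, λ* and τ0 ∈ [0,1]; let ν be a probability measure on (0,∞)² (the joint fading states h = (h1,h2)). Define ξ(h) := ( ((w1·h1)/(ln 2·μ1))^{w1} / ((w2·h2)/(ln 2·μ2))^{w2} )^{1/(w2−w1)} and g(x,h) := x·( w2·log(x·w2·h2/(ln 2·μ2)) − w1·log(x·w1·h1/(ln 2·μ1)) − (w2−w1)/ln 2 ) + μ2/h2 − μ1/h1. Define the policy (τ1*, r1*, τ2*, r2*)(h) as follows: if μ1/(w1·h1) ≥ μ2/(w2·h2), set τ1* = 0, r1* = 0, τ2* = 1, r2* = max(0, log λ* − log(ln 2·μ2/(w2·h2))); if μ1/(w1·h1) < μ2/(w2·h2) and (λ* ≤ ξ(h) or g(λ*,h) < 0), set τ1* = 1, r1* = max(0, log λ* − log(ln 2·μ1/(w1·h1))),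 τ2* = 0, r2* = 0; if μ1/(w1·h1) < μ2/(w2·h2), λ* > ξ(h) and g(λ*,h) > 0, set τ1* = 0, r1* = 0, τ2* = 1, r2* = max(0, log λ* − log(ln 2·μ2/(w2·h2))); if μ1/(w1·h1) < μ2/(w2·h2), λ* > ξ(h) and g(λ*,h) = 0, set τ1* = τ0, τ2* = 1 − τ0 and r_k* = max(0, log λ* − log(ln 2·μ_k/(w_k·h_k))) for k = 1,2. Assume ∫ (w1·τ1*·r1* + w2·τ2*·r2*) dν = R̄ and that ∫ (μ1·(τ1*/h1)·(2^{r1*} − 1) + μ2·(τ2*/h2)·(2^{r2*} − 1)) dν is finite. Then for every measurable policy (τ1, τ2, r1, r2) : (0,∞)² → ℝ⁴ with τ1, τ2, r1, r2 ≥ 0, τ1 + τ2 = 1 everywhere, and ∫ (w1·τ1·r1 + w2·τ2·r2) dν ≥ R̄, one has ∫ (μ1·(τ1/h1)·(2^{r1} − 1) + μ2·(τ2/h2)·(2^{r2} − 1)) dν ≥ ∫ (μ1·(τ1*/h1)·(2^{r1*} − 1) + μ2·(τ2*/h2)·(2^{r2*} − 1)) dν. -/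
open MeasureTheory

/-- The Lagrangian of a single user with threshold `a` at water level `lam`, as a function of the
rate `s` in nats, normalized by the weight of the user. -/
noncomputable def userLagrangian (lam a s : ℝ) : ℝ := a * (Real.exp s - 1) - lam * s

/-- The water-filling rate, in nats, of a user with threshold `a` at water level `lam`. -/
noncomputable def waterRate (lam a : ℝ) : ℝ := max 0 (Real.log lam - Real.log a)

lemma waterRate_of_le {lam a : ℝ} (hlam : 0 < lam) (h : lam ≤ a) : waterRate lam a = 0 :=
  max_eq_left (sub_nonpos.2 (Real.log_le_log hlam h))

lemma waterRate_of_ge {lam a : ℝ} (ha : 0 < a) (h : a ≤ lam) :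
    waterRate lam a = Real.log lam - Real.log a :=
  max_eq_right (sub_nonneg.2 (Real.log_le_log ha h))

lemma userLagrangian_waterRate_of_ge {lam a : ℝ} (ha : 0 < a) (h : a ≤ lam) :
    userLagrangian lam a (waterRate lam a)
      = lam - a - lam * (Real.log lam - Real.log a) := by
  rw [userLagrangian, waterRate_of_ge ha h, Real.exp_sub, Real.exp_log ha,
    Real.exp_log (ha.trans_le h)]
  field_simp

lemma userLagrangian_waterRate_le {lam a s : ℝ} (hlam : 0 < lam) (ha : 0 < a) (hs : 0 ≤ s) :
    userLagrangian lam a (waterRate lam a) ≤ userLagrangian lam a s := by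
  rcases le_total lam a with h | h
  · rw [waterRate_of_le hlam h]
    simp only [userLagrangian, Real.exp_zero]
    nlinarith [Real.add_one_le_exp s]
  · rw [userLagrangian_waterRate_of_ge ha h, userLagrangian]
    have h1 := Real.add_one_le_exp (s - (Real.log lam - Real.log a))
    have h2 : a * Real.exp s = lam * Real.exp (s - (Real.log lam - Real.log a)) := by
      rw [Real.exp_sub, Real.exp_sub, Real.exp_log ha, Real.exp_log hlam]
      field_simp
    nlinarith

lemma userLagrangian_waterRate_nonpos {lam a : ℝ} (hlam : 0 < lam) (ha : 0 < a) :
    userLagrangian lam a (waterRate lam a) ≤ 0 := by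
  simpa [userLagrangian] using userLagrangian_waterRate_le hlam ha le_rfl

lemma userLagrangian_waterRate_mono {lam a b : ℝ} (hlam : 0 < lam) (ha : 0 < a) (hab : a ≤ b) :
    userLagrangian lam a (waterRate lam a) ≤ userLagrangian lam b (waterRate lam b) := by
  have hs : 0 ≤ waterRate lam b := le_max_left _ _
  refine (userLagrangian_waterRate_le hlam ha hs).trans ?_
  have := Real.one_le_exp hs
  unfold userLagrangian
  nlinarith

/-- The slope `(1 - exp (-u)) / u` decreases on the positive reals, in cross-multiplied form. -/
lemma mul_one_sub_exp_neg_le {u v : ℝ} (hv : 0 < v) (hvu : v ≤ u) :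
    v * (1 - Real.exp (-u)) ≤ u * (1 - Real.exp (-v)) := by
  have hu : 0 < u := hv.trans_le hvu
  have h := convexOn_exp.2 (Set.mem_univ (-u)) (Set.mem_univ 0)
    (div_nonneg hv.le hu.le) (sub_nonneg.2 ((div_le_one hu).2 hvu)) (by ring)
  have e : v / u * -u = -v := by field_simp
  simp only [smul_eq_mul, mul_zero, add_zero, Real.exp_zero, mul_one, e] at h
  have h2 := mul_le_mul_of_nonneg_left h hu.le
  have e2 : u * (v / u * Real.exp (-u) + (1 - v / u)) = v * Real.exp (-u) + u - v := by
    field_simp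
    ring
  linarith

/-- The first user is preferred when the water level lies below the balance point of the two
derivatives. -/
lemma first_user_preferred {lam a b w1 w2 : ℝ} (hlam : 0 < lam) (ha : 0 < a) (hab : a < b)
    (hw1 : 0 < w1)
    (hbal : w2 * (Real.log lam - Real.log b) ≤ w1 * (Real.log lam - Real.log a)) :
    w1 * userLagrangian lam a (waterRate lam a)
      ≤ w2 * userLagrangian lam b (waterRate lam b) := by
  have hb := ha.trans hab
  rcases le_or_gt lam b with h | h
  · have : userLagrangian lam b (waterRate lam b) = 0 := by
      rw [waterRate_of_le hlam h]
      simp [userLagrangian]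
    rw [this, mul_zero]
    exact mul_nonpos_of_nonneg_of_nonpos hw1.le (userLagrangian_waterRate_nonpos hlam ha)
  · rw [userLagrangian_waterRate_of_ge ha (hab.trans h).le, userLagrangian_waterRate_of_ge hb h.le]
    set u := Real.log lam - Real.log a with hu
    set v := Real.log lam - Real.log b with hv
    have hv0 : 0 < v := sub_pos.2 (Real.log_lt_log hb h)
    have hvu : v ≤ u := by
      have := Real.log_lt_log ha hab
      linarith
    have hu0 : 0 < u := hv0.trans_le hvu
    have ea : a = lam * Real.exp (-u) := by
      rw [hu, neg_sub, Real.exp_sub, Real.exp_log ha, Real.exp_log hlam]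
      field_simp
    have eb : b = lam * Real.exp (-v) := by
      rw [hv, neg_sub, Real.exp_sub, Real.exp_log hb, Real.exp_log hlam]
      field_simp
    have hslope := mul_one_sub_exp_neg_le hv0 hvu
    have hq : 0 ≤ v - (1 - Real.exp (-v)) := by
      have := Real.add_one_le_exp (-v)
      linarith
    have hmain : w2 * (v - (1 - Real.exp (-v))) ≤ w1 * (u - (1 - Real.exp (-u))) := by
      refine le_of_mul_le_mul_left ?_ hv0
      calc v * (w2 * (v - (1 - Real.exp (-v))))
          = (w2 * v) * (v - (1 - Real.exp (-v))) := by ring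
        _ ≤ (w1 * u) * (v - (1 - Real.exp (-v))) := mul_le_mul_of_nonneg_right hbal hq
        _ = w1 * (v * u - u * (1 - Real.exp (-v))) := by ring
        _ ≤ w1 * (v * u - v * (1 - Real.exp (-u))) := by gcongr
        _ = v * (w1 * (u - (1 - Real.exp (-u)))) := by ring
    have := mul_le_mul_of_nonneg_left hmain hlam.le
    rw [ea, eb]
    linarith

/-- The balance point of the derivatives of the two users, in logarithmic form. -/
lemma log_balance {a b w1 w2 : ℝ} (ha : 0 < a) (hb : 0 < b) (hw : w1 < w2) :
    (w2 - w1) * Real.log ((a⁻¹ ^ w1 / b⁻¹ ^ w2) ^ (1 / (w2 - w1)))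
      = w2 * Real.log b - w1 * Real.log a := by
  have hd : w2 - w1 ≠ 0 := (sub_pos.2 hw).ne'
  have ha' := inv_pos.2 ha
  have hb' := inv_pos.2 hb
  rw [Real.log_rpow (div_pos (Real.rpow_pos_of_pos ha' _) (Real.rpow_pos_of_pos hb' _)),
    Real.log_div (Real.rpow_pos_of_pos ha' _).ne' (Real.rpow_pos_of_pos hb' _).ne',
    Real.log_rpow ha', Real.log_rpow hb', Real.log_inv, Real.log_inv]
  field_simp
  ring

/-- Cost minus `lam` times the weighted rate of a user, through the normalized Lagrangian. -/
lemma cost_sub_rate_eq {w μ h lam τ r : ℝ} (hw : 0 < w) (hh : 0 < h) :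
    μ * (τ / h) * ((2 : ℝ) ^ r - 1) - lam * (w * τ * r)
      = τ * (w * userLagrangian lam (Real.log 2 * μ / (w * h)) (Real.log 2 * r))
          / Real.log 2 := by
  have hl : 0 < Real.log 2 := Real.log_pos one_lt_two
  rw [userLagrangian, Real.rpow_def_of_pos two_pos]
  field_simp

lemma log_two_mul_rate (lam a : ℝ) :
    Real.log 2 * max 0 (Real.logb 2 lam - Real.logb 2 a) = waterRate lam a := by
  have hl : 0 < Real.log 2 := Real.log_pos one_lt_two
  rw [waterRate, mul_max_of_nonneg _ _ hl.le, Real.logb, Real.logb]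
  congr 1
  · ring
  · field_simp

/-- Integrated form of weak duality: a policy minimizing the Lagrangian pointwise has minimal
cost among all policies of at least the same finite rate. -/
lemma lintegral_cost_le_of_lagrangian_le {α : Type*} [MeasurableSpace α] {ν : Measure α}
    {cs rs c r : α → ℝ} {lam : ℝ} (hlam : 0 ≤ lam) (hrs : Measurable rs)
    (hfin : ∫⁻ x, ENNReal.ofReal (rs x) ∂ν ≠ ⊤)
    (hrate : ∫⁻ x, ENNReal.ofReal (rs x) ∂ν ≤ ∫⁻ x, ENNReal.ofReal (r x) ∂ν)
    (h : ∀ᵐ x ∂ν, 0 ≤ cs x ∧ 0 ≤ r x ∧ cs x - lam * rs x ≤ c x - lam * r x) :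
    ∫⁻ x, ENNReal.ofReal (cs x) ∂ν ≤ ∫⁻ x, ENNReal.ofReal (c x) ∂ν := by
  have hpt : ∀ᵐ x ∂ν, ENNReal.ofReal (cs x) + ENNReal.ofReal lam * ENNReal.ofReal (r x)
      ≤ ENNReal.ofReal (c x) + ENNReal.ofReal lam * ENNReal.ofReal (rs x) := by
    filter_upwards [h] with x ⟨h1, h2, h3⟩
    rw [← ENNReal.ofReal_mul hlam, ← ENNReal.ofReal_mul hlam,
      ← ENNReal.ofReal_add h1 (mul_nonneg hlam h2)]
    exact (ENNReal.ofReal_le_ofReal (by linarith)).trans ENNReal.ofReal_add_le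
  have hne : ENNReal.ofReal lam * ∫⁻ x, ENNReal.ofReal (rs x) ∂ν ≠ ⊤ :=
    ENNReal.mul_ne_top ENNReal.ofReal_ne_top hfin
  refine (ENNReal.add_le_add_iff_right hne).1 ?_
  calc ∫⁻ x, ENNReal.ofReal (cs x) ∂ν + ENNReal.ofReal lam * ∫⁻ x, ENNReal.ofReal (rs x) ∂ν
      ≤ ∫⁻ x, ENNReal.ofReal (cs x) ∂ν
          + ∫⁻ x, ENNReal.ofReal lam * ENNReal.ofReal (r x) ∂ν := by
        rw [lintegral_const_mul' _ _ ENNReal.ofReal_ne_top]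
        gcongr
    _ ≤ ∫⁻ x, (ENNReal.ofReal (cs x) + ENNReal.ofReal lam * ENNReal.ofReal (r x)) ∂ν :=
        le_lintegral_add _ _
    _ ≤ ∫⁻ x, (ENNReal.ofReal (c x) + ENNReal.ofReal lam * ENNReal.ofReal (rs x)) ∂ν :=
        lintegral_mono_ae hpt
    _ = ∫⁻ x, ENNReal.ofReal (c x) ∂ν
          + ENNReal.ofReal lam * ∫⁻ x, ENNReal.ofReal (rs x) ∂ν := by
        rw [lintegral_add_right _ (hrs.ennreal_ofReal.const_mul _),
          lintegral_const_mul' _ _ ENNReal.ofReal_ne_top]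

open MeasureTheory

/-- optimality of the two-user water-filling policy (with water level `λ*` and
tie-breaking fraction `τ0`) for total-power minimization under a weighted sum average rate
constraint over the fading distribution `ν`. -/
theorem stmt10 (w1 w2 μ1 μ2 lam τ0 Rbar : ℝ)
    (hw1 : 0 < w1) (hw2 : 0 < w2) (hw : w1 < w2)
    (hμ1 : 0 < μ1) (hμ2 : 0 < μ2) (hlam : 0 < lam)
    (hτ0 : 0 ≤ τ0) (hτ0' : τ0 ≤ 1)
    (ν : Measure (ℝ × ℝ)) [IsProbabilityMeasure ν]
    (hν : ∀ᵐ h ∂ν, 0 < h.1 ∧ 0 < h.2)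
    (ξ : ℝ × ℝ → ℝ)
    (hξ : ∀ h : ℝ × ℝ, ξ h = ((w1 * h.1 / (Real.log 2 * μ1)) ^ w1 /
        (w2 * h.2 / (Real.log 2 * μ2)) ^ w2) ^ (1 / (w2 - w1)))
    (g : ℝ → ℝ × ℝ → ℝ)
    (hg : ∀ (x : ℝ) (h : ℝ × ℝ), g x h =
        x * (w2 * Real.logb 2 (x * w2 * h.2 / (Real.log 2 * μ2))
          - w1 * Real.logb 2 (x * w1 * h.1 / (Real.log 2 * μ1))
          - (w2 - w1) / Real.log 2) + μ2 / h.2 - μ1 / h.1)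
    -- the water-filling policy (τ1*, r1*, τ2*, r2*)
    (τ1s τ2s r1s r2s : ℝ × ℝ → ℝ)
    (hτ1s_meas : Measurable τ1s) (hτ2s_meas : Measurable τ2s)
    (hr1s_meas : Measurable r1s) (hr2s_meas : Measurable r2s)
    (hcase1 : ∀ h : ℝ × ℝ, 0 < h.1 → 0 < h.2 →
      μ2 / (w2 * h.2) ≤ μ1 / (w1 * h.1) →
      τ1s h = 0 ∧ r1s h = 0 ∧ τ2s h = 1 ∧
        r2s h = max 0 (Real.logb 2 lam - Real.logb 2 (Real.log 2 * μ2 / (w2 * h.2))))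
    (hcase2 : ∀ h : ℝ × ℝ, 0 < h.1 → 0 < h.2 →
      μ1 / (w1 * h.1) < μ2 / (w2 * h.2) → (lam ≤ ξ h ∨ g lam h < 0) →
      τ1s h = 1 ∧
        r1s h = max 0 (Real.logb 2 lam - Real.logb 2 (Real.log 2 * μ1 / (w1 * h.1))) ∧
        τ2s h = 0 ∧ r2s h = 0)
    (hcase3 : ∀ h : ℝ × ℝ, 0 < h.1 → 0 < h.2 →
      μ1 / (w1 * h.1) < μ2 / (w2 * h.2) → ξ h < lam → 0 < g lam h →
      τ1s h = 0 ∧ r1s h = 0 ∧ τ2s h = 1 ∧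
        r2s h = max 0 (Real.logb 2 lam - Real.logb 2 (Real.log 2 * μ2 / (w2 * h.2))))
    (hcase4 : ∀ h : ℝ × ℝ, 0 < h.1 → 0 < h.2 →
      μ1 / (w1 * h.1) < μ2 / (w2 * h.2) → ξ h < lam → g lam h = 0 →
      τ1s h = τ0 ∧ τ2s h = 1 - τ0 ∧
        r1s h = max 0 (Real.logb 2 lam - Real.logb 2 (Real.log 2 * μ1 / (w1 * h.1))) ∧
        r2s h = max 0 (Real.logb 2 lam - Real.logb 2 (Real.log 2 * μ2 / (w2 * h.2))))
    -- the policy meets the weighted sum average rate constraint with equality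
    (hrate : ∫⁻ h, ENNReal.ofReal (w1 * τ1s h * r1s h + w2 * τ2s h * r2s h) ∂ν
      = ENNReal.ofReal Rbar)
    -- and has finite expected weighted power cost
    (hcost_fin : ∫⁻ h, ENNReal.ofReal (μ1 * (τ1s h / h.1) * ((2 : ℝ) ^ r1s h - 1)
        + μ2 * (τ2s h / h.2) * ((2 : ℝ) ^ r2s h - 1)) ∂ν ≠ ⊤) :
    ∀ τ1 τ2 r1 r2 : ℝ × ℝ → ℝ,
      Measurable τ1 → Measurable τ2 → Measurable r1 → Measurable r2 →
      (∀ h, 0 ≤ τ1 h) → (∀ h, 0 ≤ τ2 h) → (∀ h, 0 ≤ r1 h) → (∀ h, 0 ≤ r2 h) →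
      (∀ h, τ1 h + τ2 h = 1) →
      ENNReal.ofReal Rbar ≤
        ∫⁻ h, ENNReal.ofReal (w1 * τ1 h * r1 h + w2 * τ2 h * r2 h) ∂ν →
      ∫⁻ h, ENNReal.ofReal (μ1 * (τ1s h / h.1) * ((2 : ℝ) ^ r1s h - 1)
          + μ2 * (τ2s h / h.2) * ((2 : ℝ) ^ r2s h - 1)) ∂ν ≤
        ∫⁻ h, ENNReal.ofReal (μ1 * (τ1 h / h.1) * ((2 : ℝ) ^ r1 h - 1)
          + μ2 * (τ2 h / h.2) * ((2 : ℝ) ^ r2 h - 1)) ∂ν := by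
  intro τ1 τ2 r1 r2 _ _ _ _ hτ1 hτ2 hr1 hr2 hsum hR
  refine lintegral_cost_le_of_lagrangian_le (lam := lam) hlam.le
    (rs := fun h => w1 * τ1s h * r1s h + w2 * τ2s h * r2s h)
    (r := fun h => w1 * τ1 h * r1 h + w2 * τ2 h * r2 h)
    (by fun_prop) (hrate ▸ ENNReal.ofReal_ne_top) (hrate ▸ hR) ?_
  filter_upwards [hν] with h ⟨h1, h2⟩
  have hl : 0 < Real.log 2 := Real.log_pos one_lt_two
  set a := Real.log 2 * μ1 / (w1 * h.1) with ha_def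
  set b := Real.log 2 * μ2 / (w2 * h.2) with hb_def
  have ha : 0 < a := by positivity
  have hb : 0 < b := by positivity
  have ea : a = Real.log 2 * (μ1 / (w1 * h.1)) := mul_div_assoc _ _ _
  have eb : b = Real.log 2 * (μ2 / (w2 * h.2)) := mul_div_assoc _ _ _
  set V1 := w1 * userLagrangian lam a (waterRate lam a) with hV1
  set V2 := w2 * userLagrangian lam b (waterRate lam b) with hV2
  -- the policy is nonnegative and attains the smaller of the two Lagrangian values
  have key : 0 ≤ τ1s h ∧ 0 ≤ τ2s h ∧ 0 ≤ r1s h ∧ 0 ≤ r2s h ∧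
      ∃ M, M ≤ V1 ∧ M ≤ V2 ∧
        τ1s h * (w1 * userLagrangian lam a (Real.log 2 * r1s h))
          + τ2s h * (w2 * userLagrangian lam b (Real.log 2 * r2s h)) = M := by
    rcases le_or_gt (μ2 / (w2 * h.2)) (μ1 / (w1 * h.1)) with hab | hab
    · obtain ⟨e1, e2, e3, e4⟩ := hcase1 h h1 h2 hab
      have hba : b ≤ a := by
        rw [ea, eb]
        gcongr
      have hV : V2 ≤ V1 := by
        have m := userLagrangian_waterRate_mono hlam hb hba
        have n := userLagrangian_waterRate_nonpos hlam ha
        nlinarith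
      refine ⟨e1.ge, by simp [e3], e2.ge, by simp [e4], V2, hV, le_rfl, ?_⟩
      rw [e1, e3, e4, log_two_mul_rate]
      ring
    · have hab' : a < b := by
        rw [ea, eb]
        gcongr
      have hξlog : (w2 - w1) * Real.log (ξ h) = w2 * Real.log b - w1 * Real.log a := by
        rw [← log_balance ha hb hw, hξ, ha_def, hb_def, inv_div, inv_div]
      have hξpos : 0 < ξ h := by
        rw [hξ]
        positivity
      have hd : 0 < w2 - w1 := sub_pos.2 hw
      have hlt : Real.log a < Real.log b := Real.log_lt_log ha hab'
      have pref : lam ≤ ξ h → V1 ≤ V2 := fun hle =>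
        first_user_preferred hlam ha hab' hw1 (by
          nlinarith [Real.log_le_log hlam hle])
      have gval : ξ h < lam → g lam h = (V1 - V2) / Real.log 2 := fun hgt => by
        have hbl : b < lam := by
          refine (Real.log_lt_log_iff hb hlam).1 (lt_trans ?_ (Real.log_lt_log hξpos hgt))
          nlinarith
        have q1 : lam * w1 * h.1 / (Real.log 2 * μ1) = lam / a := by
          rw [ha_def]
          field_simp
        have q2 : lam * w2 * h.2 / (Real.log 2 * μ2) = lam / b := by
          rw [hb_def]
          field_simp
        have c1 : μ1 / h.1 = w1 * a / Real.log 2 := by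
          rw [ha_def]
          field_simp
        have c2 : μ2 / h.2 = w2 * b / Real.log 2 := by
          rw [hb_def]
          field_simp
        rw [hg, q1, q2, c1, c2, hV1, hV2, userLagrangian_waterRate_of_ge ha (hab'.trans hbl).le,
          userLagrangian_waterRate_of_ge hb hbl.le, Real.logb, Real.logb,
          Real.log_div hlam.ne' ha.ne', Real.log_div hlam.ne' hb.ne']
        field_simp
        ring
      by_cases hc : lam ≤ ξ h ∨ g lam h < 0
      · obtain ⟨e1, e2, e3, e4⟩ := hcase2 h h1 h2 hab hc
        have hV : V1 ≤ V2 := by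
          rcases le_or_gt lam (ξ h) with hle | hgt
          · exact pref hle
          · have hneg := hc.resolve_left hgt.not_ge
            rw [gval hgt, div_lt_iff₀ hl] at hneg
            linarith
        refine ⟨by simp [e1], e3.ge, by simp [e2], e4.ge, V1, le_rfl, hV, ?_⟩
        rw [e1, e2, e3, log_two_mul_rate]
        ring
      · push Not at hc
        obtain ⟨hgt, hg0⟩ := hc
        rcases hg0.lt_or_eq with hpos | hzero
        · obtain ⟨e1, e2, e3, e4⟩ := hcase3 h h1 h2 hab hgt hpos
          have hV : V2 ≤ V1 := by
            rw [gval hgt, lt_div_iff₀ hl] at hpos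
            linarith
          refine ⟨e1.ge, by simp [e3], e2.ge, by simp [e4], V2, hV, le_rfl, ?_⟩
          rw [e1, e3, e4, log_two_mul_rate]
          ring
        · obtain ⟨e1, e2, e3, e4⟩ := hcase4 h h1 h2 hab hgt hzero.symm
          have hV : V1 = V2 := by
            rw [gval hgt, eq_div_iff hl.ne'] at hzero
            linarith
          refine ⟨by rwa [e1], by rw [e2]; linarith, by simp [e3], by simp [e4], V1, le_rfl,
            hV.le, ?_⟩
          rw [e1, e2, e3, e4, log_two_mul_rate, log_two_mul_rate, ← hV1, ← hV2, ← hV]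
          ring
  obtain ⟨p1, p2, p3, p4, M, hM1, hM2, hM⟩ := key
  refine ⟨?_, ?_, ?_⟩
  · have k1 : 0 ≤ (2 : ℝ) ^ r1s h - 1 := sub_nonneg.2 (Real.one_le_rpow one_le_two p3)
    have k2 : 0 ≤ (2 : ℝ) ^ r2s h - 1 := sub_nonneg.2 (Real.one_le_rpow one_le_two p4)
    positivity
  · have := hτ1 h
    have := hτ2 h
    have := hr1 h
    have := hr2 h
    positivity
  · have split : ∀ t1 t2 s1 s2 : ℝ,
        μ1 * (t1 / h.1) * ((2 : ℝ) ^ s1 - 1) + μ2 * (t2 / h.2) * ((2 : ℝ) ^ s2 - 1)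
            - lam * (w1 * t1 * s1 + w2 * t2 * s2)
          = (t1 * (w1 * userLagrangian lam a (Real.log 2 * s1))
              + t2 * (w2 * userLagrangian lam b (Real.log 2 * s2))) / Real.log 2 := by
      intro t1 t2 s1 s2
      rw [add_div, ha_def, hb_def, ← cost_sub_rate_eq hw1 h1, ← cost_sub_rate_eq hw2 h2]
      ring
    rw [split, split, hM]
    refine div_le_div_of_nonneg_right ?_ hl.le
    have f1 : M ≤ w1 * userLagrangian lam a (Real.log 2 * r1 h) := hM1.trans <|
      mul_le_mul_of_nonneg_left
        (userLagrangian_waterRate_le hlam ha (mul_nonneg hl.le (hr1 h))) hw1.le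
    have f2 : M ≤ w2 * userLagrangian lam b (Real.log 2 * r2 h) := hM2.trans <|
      mul_le_mul_of_nonneg_left
        (userLagrangian_waterRate_le hlam hb (mul_nonneg hl.le (hr2 h))) hw2.le
    calc M = τ1 h * M + τ2 h * M := by rw [← add_mul, hsum, one_mul]
      _ ≤ _ := add_le_add (mul_le_mul_of_nonneg_left f1 (hτ1 h))
        (mul_le_mul_of_nonneg_left f2 (hτ2 h))
end

section
/- Let K ≥ 1, let ν be a probability measure on (0,∞)^K (the joint fading states h = (h_1,…,h_K)), and fix μ_k > 0, λ_k* > 0 and R̄_k > 0 for k = 1,…,K. Define r_{k,min}(h) := max(0, log(λ_k*·h_k/(ln 2·μ_k))) and F_k(h) := (μ_k/h_k)·(2^{r_{k,min}(h)} − 1) − λ_k*·r_{k,min}(h). Suppose (τ*, r*) : (0,∞)^K → ℝ^{2K} is measurable with, for ν-almost every h: τ_k*(h) ≥ 0, ∑_{k=1}^K τ_k*(h) = 1, and whenever τ_k*(h) > 0 one has r_k*(h) = r_{k,min}(h) and F_k(h) = min_{1 ≤ i ≤ K} F_i(h); suppose also ∫ τ_k*(h)·r_k*(h) dν(h) = R̄_k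 for every k and ∑_k μ_k·∫ (τ_k*(h)/h_k)·(2^{r_k*(h)} − 1) dν(h) is finite. Then for every measurable policy (τ, r) : (0,∞)^K → ℝ^{2K} with τ_k ≥ 0, ∑_k τ_k = 1 everywhere, r_k ≥ 0, the relevant integrals finite, and ∫ τ_k(h)·r_k(h) dν(h) ≥ R̄_k for every k, one has ∑_{k=1}^K μ_k·∫ (τ_k(h)/h_k)·(2^{r_k(h)} − 1) dν(h) ≥ ∑_{k=1}^K μ_k·∫ (τ_k*(h)/h_k)·(2^{r_k*(h)} − 1) dν(h). -/
open MeasureTheory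

/-- The water-filling rate minimizes power cost minus rate reward over nonnegative rates. -/
theorem waterfilling_rate_optimal {a l r m : ℝ} (ha : 0 < a) (hl : 0 < l) (hr : 0 ≤ r)
    (hm : m = max 0 (Real.logb 2 (l / (Real.log 2 * a)))) :
    a * ((2 : ℝ) ^ m - 1) - l * m ≤ a * ((2 : ℝ) ^ r - 1) - l * r := by
  have h2 : 0 < Real.log 2 := Real.log_pos one_lt_two
  have hpos : 0 < l / (Real.log 2 * a) := by positivity
  have hpm : (0 : ℝ) < 2 ^ m := by positivity
  have tangent : (2 : ℝ) ^ m * (1 + Real.log 2 * (r - m)) ≤ 2 ^ r := by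
    have h := Real.add_one_le_exp (Real.log 2 * (r - m))
    have he : (2 : ℝ) ^ r = 2 ^ m * Real.exp (Real.log 2 * (r - m)) := by
      rw [← Real.rpow_def_of_pos two_pos, ← Real.rpow_add two_pos, add_sub_cancel]
    rw [he]
    gcongr
    linarith
  have hscaled := mul_le_mul_of_nonneg_left tangent ha.le
  rcases le_total (Real.logb 2 (l / (Real.log 2 * a))) 0 with h | h
  · rw [max_eq_left h] at hm
    subst hm
    have hle : l ≤ Real.log 2 * a := by
      have h1 : l / (Real.log 2 * a) ≤ 1 := by
        by_contra! hc
        exact absurd h (not_le.mpr (Real.logb_pos one_lt_two hc))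
      rwa [div_le_one (by positivity)] at h1
    have := mul_le_mul_of_nonneg_right hle hr
    simp only [Real.rpow_zero] at *
    nlinarith
  · rw [max_eq_right h] at hm
    have hpow : (2 : ℝ) ^ m = l / (Real.log 2 * a) := by
      rw [hm, Real.rpow_logb two_pos (by norm_num) hpos]
    have hslope : a * (2 : ℝ) ^ m * Real.log 2 = l := by
      rw [hpow]
      field_simp
    have : a * ((2 : ℝ) ^ m * (1 + Real.log 2 * (r - m))) = a * 2 ^ m + l * (r - m) := by
      rw [← hslope]
      ring
    linarith

/-- optimality of the greedy water-filling policy with rate-reward vector `λ*`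
for weighted total-power minimization under individual average rate constraints over the
fading distribution `ν`. -/
theorem stmt16 (K : ℕ) (hK : 1 ≤ K)
    (ν : Measure (Fin K → ℝ)) [IsProbabilityMeasure ν]
    (hν : ∀ᵐ h ∂ν, ∀ k, 0 < h k)
    (μ lam Rbar : Fin K → ℝ)
    (hμ : ∀ k, 0 < μ k) (hlam : ∀ k, 0 < lam k) (hRbar : ∀ k, 0 < Rbar k)
    (rmin : (Fin K → ℝ) → Fin K → ℝ)
    (hrmin : ∀ (h : Fin K → ℝ) k,
      rmin h k = max 0 (Real.logb 2 (lam k * h k / (Real.log 2 * μ k))))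
    (F : (Fin K → ℝ) → Fin K → ℝ)
    (hF : ∀ (h : Fin K → ℝ) k,
      F h k = μ k / h k * ((2 : ℝ) ^ rmin h k - 1) - lam k * rmin h k)
    -- the greedy water-filling policy (τ*, r*)
    (τs rs : (Fin K → ℝ) → Fin K → ℝ)
    (hτs_meas : ∀ k, Measurable fun h => τs h k)
    (hrs_meas : ∀ k, Measurable fun h => rs h k)
    (hstar : ∀ᵐ h ∂ν, (∀ k, 0 ≤ τs h k) ∧ (∑ k, τs h k) = 1 ∧
      ∀ k, 0 < τs h k → rs h k = rmin h k ∧ F h k = ⨅ i, F h i)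
    -- it meets the individual average rate constraints with equality
    (hrate_int : ∀ k, Integrable (fun h => τs h k * rs h k) ν)
    (hrate : ∀ k, ∫ h, τs h k * rs h k ∂ν = Rbar k)
    -- and its weighted power cost is finite
    (hcost_int : ∀ k, Integrable (fun h => τs h k / h k * ((2 : ℝ) ^ rs h k - 1)) ν) :
    ∀ τ r : (Fin K → ℝ) → Fin K → ℝ,
      (∀ k, Measurable fun h => τ h k) → (∀ k, Measurable fun h => r h k) →
      (∀ h k, 0 ≤ τ h k) → (∀ h : Fin K → ℝ, (∑ k, τ h k) = 1) → (∀ h k, 0 ≤ r h k) →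
      (∀ k, Integrable (fun h => τ h k * r h k) ν) →
      (∀ k, Integrable (fun h => τ h k / h k * ((2 : ℝ) ^ r h k - 1)) ν) →
      (∀ k, Rbar k ≤ ∫ h, τ h k * r h k ∂ν) →
      (∑ k, μ k * ∫ h, τs h k / h k * ((2 : ℝ) ^ rs h k - 1) ∂ν) ≤
        ∑ k, μ k * ∫ h, τ h k / h k * ((2 : ℝ) ^ r h k - 1) ∂ν := by
  intro τ r _ _ hτ hτsum hr hint hcint hR
  have integrable_lagrangian : ∀ t q : (Fin K → ℝ) → Fin K → ℝ,
      (∀ k, Integrable (fun h => t h k * q h k) ν) →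
      (∀ k, Integrable (fun h => t h k / h k * ((2 : ℝ) ^ q h k - 1)) ν) →
      ∀ k, Integrable (fun h => μ k * (t h k / h k * ((2 : ℝ) ^ q h k - 1))
        - lam k * (t h k * q h k)) ν := fun t q h1 h2 k =>
    ((h2 k).const_mul _).sub ((h1 k).const_mul _)
  have integral_lagrangian : ∀ t q : (Fin K → ℝ) → Fin K → ℝ,
      (∀ k, Integrable (fun h => t h k * q h k) ν) →
      (∀ k, Integrable (fun h => t h k / h k * ((2 : ℝ) ^ q h k - 1)) ν) →
      ∫ h, ∑ k, (μ k * (t h k / h k * ((2 : ℝ) ^ q h k - 1)) - lam k * (t h k * q h k)) ∂ν =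
        (∑ k, μ k * ∫ h, t h k / h k * ((2 : ℝ) ^ q h k - 1) ∂ν)
          - ∑ k, lam k * ∫ h, t h k * q h k ∂ν := by
    intro t q h1 h2
    rw [integral_finsetSum _ fun k _ => integrable_lagrangian t q h1 h2 k,
      ← Finset.sum_sub_distrib]
    refine Finset.sum_congr rfl fun k _ => ?_
    rw [integral_sub ((h2 k).const_mul _) ((h1 k).const_mul _), integral_const_mul,
      integral_const_mul]
  have pointwise : ∀ᵐ h ∂ν,
      ∑ k, (μ k * (τs h k / h k * ((2 : ℝ) ^ rs h k - 1)) - lam k * (τs h k * rs h k)) ≤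
        ∑ k, (μ k * (τ h k / h k * ((2 : ℝ) ^ r h k - 1)) - lam k * (τ h k * r h k)) := by
    filter_upwards [hν, hstar] with h hpos ⟨hτs, hτs_sum, hgreedy⟩
    calc
      _ = ∑ k, τs h k * ⨅ i, F h i := by
        refine Finset.sum_congr rfl fun k _ => ?_
        rcases (hτs k).eq_or_lt with h0 | h0
        · simp [← h0]
        · obtain ⟨hrs, hFk⟩ := hgreedy k h0
          rw [← hFk, hF, hrs]
          ring
      _ = ∑ k, τ h k * ⨅ i, F h i := by
        rw [← Finset.sum_mul, ← Finset.sum_mul, hτs_sum, hτsum]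
      _ ≤ ∑ k, τ h k * (μ k / h k * ((2 : ℝ) ^ r h k - 1) - lam k * r h k) := by
        refine Finset.sum_le_sum fun k _ => mul_le_mul_of_nonneg_left ?_ (hτ h k)
        refine (ciInf_le (Set.finite_range (F h)).bddBelow k).trans ?_
        rw [hF]
        refine waterfilling_rate_optimal (div_pos (hμ k) (hpos k)) (hlam k) (hr h k) ?_
        rw [hrmin, ← mul_div_assoc, div_div_eq_mul_div]
      _ = _ := Finset.sum_congr rfl fun k _ => by ring
  have key := integral_mono_ae
    (integrable_finsetSum _ fun k _ => integrable_lagrangian τs rs hrate_int hcost_int k)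
    (integrable_finsetSum _ fun k _ => integrable_lagrangian τ r hint hcint k) pointwise
  rw [integral_lagrangian τs rs hrate_int hcost_int, integral_lagrangian τ r hint hcint] at key
  have reward : ∑ k, lam k * ∫ h, τs h k * rs h k ∂ν ≤ ∑ k, lam k * ∫ h, τ h k * r h k ∂ν :=
    Finset.sum_le_sum fun k _ =>
      mul_le_mul_of_nonneg_left ((hrate k).le.trans (hR k)) (hlam k).le
  linarith
end

section
/- Let K ≥ 1 and let Λ : ℝ^K → ℝ^K be continuous and order preserving with respect to the componentwise partial order (x ≤ y implies Λ(x) ≤ Λ(y)), and suppose Λ has a unique fixed point λ*. Let λ(0) ∈ ℝ^K and suppose there exist α, β ∈ ℝ^K with α ≤ λ(0) ≤ β, α ≤ Λ(α) and Λ(β) ≤ β. Then the iterates λ(l) := Λ^l(λ(0)) converge to λ* as l → ∞. -/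
/-- the monotone-iteration convergence principle: if `Λ : ℝ^K → ℝ^K` is
continuous and order preserving with unique fixed point `λ*`, and the initialization is
bracketed by a sub-solution `α ≤ Λ(α)` and a super-solution `Λ(β) ≤ β`, then the iterates
`Λ^l(λ(0))` converge to `λ*`. -/
theorem stmt18 (K : ℕ) (hK : 1 ≤ K)
    (Λ : (Fin K → ℝ) → (Fin K → ℝ))
    (hcont : Continuous Λ) (hmono : Monotone Λ)
    (lamstar : Fin K → ℝ) (hfix : Λ lamstar = lamstar)
    (huniq : ∀ x : Fin K → ℝ, Λ x = x → x = lamstar)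
    (lam0 α β : Fin K → ℝ)
    (hα0 : α ≤ lam0) (h0β : lam0 ≤ β)
    (hα : α ≤ Λ α) (hβ : Λ β ≤ β) :
    Filter.Tendsto (fun l : ℕ => Λ^[l] lam0) Filter.atTop (nhds lamstar) := by
  have hup : Monotone fun l : ℕ => Λ^[l] α := hmono.monotone_iterate_of_le_map hα
  have hdown : Antitone fun l : ℕ => Λ^[l] β := hmono.antitone_iterate_of_map_le hβ
  have hle (l : ℕ) : Λ^[l] α ≤ Λ^[l] β := hmono.iterate l (hα0.trans h0β)
  have hbddAbove : BddAbove (Set.range fun l : ℕ => Λ^[l] α) :=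
    ⟨β, Set.forall_mem_range.2 fun l => (hle l).trans (hdown l.zero_le)⟩
  have hbddBelow : BddBelow (Set.range fun l : ℕ => Λ^[l] β) :=
    ⟨α, Set.forall_mem_range.2 fun l => (hup l.zero_le).trans (hle l)⟩
  have hlim_up := tendsto_atTop_ciSup hup hbddAbove
  have hlim_down := tendsto_atTop_ciInf hdown hbddBelow
  rw [huniq _ (isFixedPt_of_tendsto_iterate hlim_up hcont.continuousAt)] at hlim_up
  rw [huniq _ (isFixedPt_of_tendsto_iterate hlim_down hcont.continuousAt)] at hlim_down
  rw [tendsto_pi_nhds] at hlim_up hlim_down ⊢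
  exact fun k => tendsto_of_tendsto_of_tendsto_of_le_of_le (hlim_up k) (hlim_down k)
    (fun l => hmono.iterate l hα0 k) (fun l => hmono.iterate l h0β k)
end

section
/- Let K ≥ 1 and for each k ∈ {1,…,K} let M_k ≥ 1, let 0 = ρ_{k,0} < ρ_{k,1} < ⋯ < ρ_{k,M_k} and 0 = p_{k,0} ≤ p_{k,1} ≤ ⋯ ≤ p_{k,M_k} be reals whose slopes γ_{k,l} := (p_{k,l} − p_{k,l−1})/(ρ_{k,l} − ρ_{k,l−1}) satisfy 0 < γ_{k,1} < ⋯ < γ_{k,M_k}, and let μ_k, h_k, λ_k > 0. Set l_k* := max{ l ∈ {1,…,M_k} : μ_k·γ_{k,l}/h_k ≤ λ_k } when this set is nonempty and l_k* := 0 otherwise, and φ_k := μ_k·p_{k,l_k*}/h_k − λ_k·ρ_{k,l_k*}. Then for all nonnegative weights τ̃_{k,l} (k ∈ {1,…,K}, l ∈ {0,…,M_k}) with ∑_{k=1}^K ∑_{l=0}^{M_k} τ̃_{k,l} = 1, one has ∑_{k=1}^K ∑_{l=0}^{M_k} τ̃_{k,l}·( μ_k·p_{k,l}/h_k − λ_k·ρ_{k,l}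 ) ≥ min_{1 ≤ k ≤ K} φ_k, with equality attained by placing all weight on (k, l_k*) for any k achieving the minimum of φ_k. -/
/-- A sequence that decreases up to `s` and increases from `s` to `m` is minimal at `s`. -/
theorem le_of_antitone_up_to_of_monotone_after {f : ℕ → ℝ} {s m : ℕ}
    (hdown : ∀ l, l < s → f (l + 1) ≤ f l)
    (hup : ∀ l, s ≤ l → l < m → f l ≤ f (l + 1)) {l : ℕ} (hl : l ≤ m) : f s ≤ f l := by
  rcases le_total s l with hsl | hls
  · induction l, hsl using Nat.le_induction with
    | base => exact le_rfl
    | succ n hn ih => exact (ih (by omega)).trans (hup n hn (by omega))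
  · clear hup
    induction s, hls using Nat.le_induction with
    | base => exact le_rfl
    | succ n hn ih =>
      exact (hdown n (by omega)).trans (ih fun j hj => hdown j (by omega))

/-- Slopes that increase at each step up to `m` are monotone on `{1, …, m}`. -/
theorem slope_le_of_lt_succ {γ : ℕ → ℝ} {m : ℕ}
    (hγ : ∀ l : ℕ, 1 ≤ l → l < m → γ l < γ (l + 1))
    {i j : ℕ} (hi : 1 ≤ i) (hij : i ≤ j) (hj : j ≤ m) : γ i ≤ γ j := by
  induction j, hij using Nat.le_induction with
  | base => exact le_rfl
  | succ n hn ih => exact (ih (by omega)).trans (hγ n (by omega) (by omega)).le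

/-- The increment of the Lagrangian cost between consecutive modes. -/
theorem cost_sub_cost {μ h lam p p' ρ ρ' γ : ℝ} (hρ : ρ < ρ')
    (hγ : γ = (p' - p) / (ρ' - ρ)) :
    (μ * p' / h - lam * ρ') - (μ * p / h - lam * ρ) = (μ * γ / h - lam) * (ρ' - ρ) := by
  have hp : γ * (ρ' - ρ) = p' - p := by
    rw [hγ, div_mul_cancel₀ _ (sub_pos.2 hρ).ne']
  linear_combination (-μ / h) * hp


/-- the per-fading-state greedy finite-AMC-mode optimization: any time-sharing
over all users' AMC modes has Lagrangian cost at least `min_k φ_k`, the minimum channel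
quality indicator, with equality attained by placing all weight on the water-filling mode
`l_k*` of a user achieving the minimum. -/
theorem stmt19 (K : ℕ) (hK : 1 ≤ K)
    (M : Fin K → ℕ) (hM : ∀ k, 1 ≤ M k)
    (ρ p γ : Fin K → ℕ → ℝ)
    (hρ0 : ∀ k, ρ k 0 = 0) (hp0 : ∀ k, p k 0 = 0)
    (hρmono : ∀ k (l : ℕ), 1 ≤ l → l ≤ M k → ρ k (l - 1) < ρ k l)
    (hpmono : ∀ k (l : ℕ), 1 ≤ l → l ≤ M k → p k (l - 1) ≤ p k l)
    (hγ : ∀ k (l : ℕ), 1 ≤ l → l ≤ M k →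
      γ k l = (p k l - p k (l - 1)) / (ρ k l - ρ k (l - 1)))
    (hγ1 : ∀ k, 0 < γ k 1)
    (hγmono : ∀ k (l : ℕ), 1 ≤ l → l < M k → γ k l < γ k (l + 1))
    (μ h lam : Fin K → ℝ)
    (hμ : ∀ k, 0 < μ k) (hh : ∀ k, 0 < h k) (hlam : ∀ k, 0 < lam k)
    (lstar : Fin K → ℕ)
    (hlstar : ∀ k, (1 ≤ lstar k ∧ lstar k ≤ M k ∧ μ k * γ k (lstar k) / h k ≤ lam k ∧
        ∀ l : ℕ, 1 ≤ l → l ≤ M k → μ k * γ k l / h k ≤ lam k → l ≤ lstar k) ∨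
      (lstar k = 0 ∧ ∀ l : ℕ, 1 ≤ l → l ≤ M k → lam k < μ k * γ k l / h k))
    (φ : Fin K → ℝ)
    (hφ : ∀ k, φ k = μ k * p k (lstar k) / h k - lam k * ρ k (lstar k)) :
    (∀ τ : Fin K → ℕ → ℝ, (∀ k l, 0 ≤ τ k l) →
      (∑ k, ∑ l ∈ Finset.range (M k + 1), τ k l) = 1 →
      (⨅ k, φ k) ≤
        ∑ k, ∑ l ∈ Finset.range (M k + 1),
          τ k l * (μ k * p k l / h k - lam k * ρ k l)) ∧
    ∀ i : Fin K, φ i = (⨅ k, φ k) →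
      (∑ k, ∑ l ∈ Finset.range (M k + 1),
        (if k = i ∧ l = lstar i then (1 : ℝ) else 0) *
          (μ k * p k l / h k - lam k * ρ k l)) = ⨅ k, φ k := by
  have hls : ∀ k, lstar k ≤ M k := fun k => by
    rcases hlstar k with ⟨-, hle, -⟩ | ⟨h0, -⟩ <;> omega
  have hmin : ∀ k l, l ≤ M k → φ k ≤ μ k * p k l / h k - lam k * ρ k l := by
    intro k l hl
    have hstep : ∀ j, j < M k →
        (μ k * p k (j + 1) / h k - lam k * ρ k (j + 1)) - (μ k * p k j / h k - lam k * ρ k j)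
          = (μ k * γ k (j + 1) / h k - lam k) * (ρ k (j + 1) - ρ k j) := fun j hj =>
      cost_sub_cost (hρmono k (j + 1) (by omega) hj) (hγ k (j + 1) (by omega) hj)
    have hρpos : ∀ j, j < M k → 0 ≤ ρ k (j + 1) - ρ k j := fun j hj =>
      (sub_pos.2 (hρmono k (j + 1) (by omega) hj)).le
    rw [hφ]
    refine le_of_antitone_up_to_of_monotone_after
      (f := fun j => μ k * p k j / h k - lam k * ρ k j) (fun j hj => ?_) (fun j hsj hj => ?_) hl
    · have hjM : j < M k := hj.trans_le (hls k)
      have hcost : μ k * γ k (j + 1) / h k ≤ lam k := by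
        rcases hlstar k with ⟨-, -, hle, -⟩ | ⟨h0, -⟩
        · refine le_trans ?_ hle
          have := slope_le_of_lt_succ (hγmono k) (Nat.le_add_left 1 j) hj (hls k)
          exact div_le_div_of_nonneg_right (mul_le_mul_of_nonneg_left this (hμ k).le) (hh k).le
        · omega
      rw [← sub_nonpos, hstep j hjM]
      exact mul_nonpos_of_nonpos_of_nonneg (sub_nonpos.2 hcost) (hρpos j hjM)
    · have hcost : lam k ≤ μ k * γ k (j + 1) / h k := by
        rcases hlstar k with ⟨-, -, -, hmax⟩ | ⟨-, hlt⟩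
        · by_contra! hlt
          have := hmax (j + 1) (by omega) hj hlt.le
          omega
        · exact (hlt (j + 1) (by omega) hj).le
      rw [← sub_nonneg, hstep j hj]
      exact mul_nonneg (sub_nonneg.2 hcost) (hρpos j hj)
  refine ⟨fun τ hτ hsum => ?_, fun i hi => ?_⟩
  · calc (⨅ k, φ k) = ∑ k, ∑ l ∈ Finset.range (M k + 1), τ k l * ⨅ k, φ k := by
          simp_rw [← Finset.sum_mul]
          rw [hsum, one_mul]
      _ ≤ _ := Finset.sum_le_sum fun k _ => Finset.sum_le_sum fun l hl =>
          mul_le_mul_of_nonneg_left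
            ((ciInf_le (Set.finite_range φ).bddBelow k).trans
              (hmin k l (Finset.mem_range_succ_iff.1 hl))) (hτ k l)
  · rw [← hi, hφ i, Finset.sum_eq_single i, Finset.sum_eq_single (lstar i)]
    · simp
    · intro l _ hl
      simp [hl]
    · intro hl
      exact absurd (Finset.mem_range_succ_iff.2 (hls i)) hl
    · intro k _ hk
      simp [hk]
    · simp
end
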